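/- arXiv:1507.01301 — 14 statements merged into one kernel-verified Lean document; each statement's English description precedes it below -/
import Mathlib

section
/- Let δ : 𝒜 → ℳ be a (not necessarily continuous) linear map. If A δ(A⁻¹) + A⁻¹ δ(A) = δ(I) for every invertible element A of 𝒜, then δ is a Jordan left derivation; in particular δ(T²) = 2T δ(T) for every T ∈ 𝒜. -/
section UnitIdentities

variable {A M : Type*} [Ring A] [AddCommGroup M] [Module A M]

theorem map_one_eq_zero_of_unit_identity (δ : A →+ M)
    (h : ∀ u : Aˣ, (u : A) • δ (↑u⁻¹ : A) + (↑u⁻¹ : A) • δ (u : A) = δ 1) : δ 1 = 0 := by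
  simpa using h 1

theorem map_unit_eq_neg_smul_map_inv (δ : A →+ M)
    (h : ∀ u : Aˣ, (u : A) • δ (↑u⁻¹ : A) + (↑u⁻¹ : A) • δ (u : A) = δ 1) (u : Aˣ) :
    δ (u : A) = -(((u : A) * u) • δ (↑u⁻¹ : A)) := by
  have hu := congrArg (fun m => (u : A) • m) (h u)
  simp only [map_one_eq_zero_of_unit_identity δ h, smul_add, smul_smul, Units.mul_inv,
    one_smul, smul_zero] at hu
  exact eq_neg_of_add_eq_zero_right hu

/-- If `u` and `1 - u` are both invertible, then `δ (u²) = 2 u δ(u)`; this follows from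
`u⁻¹ + (1 - u)⁻¹ = (u (1 - u))⁻¹`. -/
theorem map_mul_self_of_add_eq_one (δ : A →+ M)
    (h : ∀ u : Aˣ, (u : A) • δ (↑u⁻¹ : A) + (↑u⁻¹ : A) • δ (u : A) = δ 1)
    (u v : Aˣ) (huv : (u : A) + v = 1) :
    δ ((u : A) * u) = (u : A) • δ (u : A) + (u : A) • δ (u : A) := by
  have hv : (v : A) = 1 - u := eq_sub_of_add_eq' huv
  have hcomm : (u : A) * v = v * u := by rw [hv]; noncomm_ring
  have hinv : (↑(v * u)⁻¹ : A) = ↑u⁻¹ + ↑v⁻¹ := by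
    calc (↑(v * u)⁻¹ : A) = ↑u⁻¹ * ((u : A) + v) * ↑v⁻¹ := by
          rw [huv, mul_inv_rev, Units.val_mul, mul_one]
      _ = ↑u⁻¹ + ↑v⁻¹ := by
          simp [mul_add, add_mul, mul_assoc, add_comm]
  have hw := map_unit_eq_neg_smul_map_inv δ h (v * u)
  have e1 : ((↑(v * u) : A) * ↑(v * u)) = (v * v) * (u * u) := by
    rw [Units.val_mul, mul_assoc, ← mul_assoc (u : A), hcomm]; simp only [mul_assoc]
  have e2 : (v * v : A) * (u * u) = (u * u) * (v * v) := by
    rw [hv]; noncomm_ring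
  have hδv : δ (v : A) = -δ (u : A) := by
    rw [hv, map_sub, map_one_eq_zero_of_unit_identity δ h, zero_sub]
  have hprod : δ ((v : A) * u) = ((v : A) * v) • δ (u : A) - ((u : A) * u) • δ (u : A) := by
    rw [hinv, map_add, smul_add, e1] at hw
    nth_rewrite 2 [e2] at hw
    have hδ (w : Aˣ) : ((w : A) * w) • δ (↑w⁻¹ : A) = -δ (w : A) := by
      rw [map_unit_eq_neg_smul_map_inv δ h w, neg_neg]
    rw [mul_smul, mul_smul ((u : A) * u), hδ u, hδ v, hδv, neg_neg, smul_neg, neg_add, neg_neg,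
      ← sub_eq_add_neg, Units.val_mul] at hw
    exact hw
  have hsub : δ ((u : A) * u) = δ (u : A) - δ ((v : A) * u) := by
    rw [← map_sub, hv]; congr 1; noncomm_ring
  rw [hsub, hprod, ← sub_smul, ← add_smul, hv]
  nth_rewrite 1 [← one_smul A (δ (u : A))]
  rw [← sub_smul]
  congr 1
  noncomm_ring

end UnitIdentities

theorem exists_isUnit_algebraMap_sub_and_sub_one {A : Type*} [NormedRing A] [NormedAlgebra ℂ A]
    [CompleteSpace A] (t : A) :
    ∃ k : ℂ, IsUnit (algebraMap ℂ A k - t) ∧ IsUnit (1 - (algebraMap ℂ A k - t)) := by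
  obtain ⟨n, hn⟩ := exists_nat_gt (‖t‖ * ‖(1 : A)‖)
  refine ⟨(n : ℂ) + 1, ?_, ?_⟩
  · refine spectrum.mem_resolventSet_of_norm_lt_mul (k := (n : ℂ) + 1) ?_
    have : ‖(n : ℂ) + 1‖ = n + 1 := by exact_mod_cast Complex.norm_natCast (n + 1)
    linarith
  · have hk : IsUnit (algebraMap ℂ A n - t) :=
      spectrum.mem_resolventSet_of_norm_lt_mul (k := (n : ℂ)) (by simpa using hn)
    convert hk.neg using 1
    rw [map_add, map_one]
    abel

/-- If `A δ(A⁻¹) + A⁻¹ δ(A) = δ(1)` for every invertible `A`, then `δ` is a Jordan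
left derivation; in particular `δ(T²) = 2 T δ(T)` for every `T`. -/
theorem stmt_0
    {A : Type*} [NormedRing A] [NormedAlgebra ℂ A] [CompleteSpace A]
    {M : Type*} [AddCommGroup M] [Module ℂ M] [Module A M] [IsScalarTower ℂ A M]
    (δ : A →ₗ[ℂ] M)
    (h : ∀ u : Aˣ, (u : A) • δ (↑u⁻¹ : A) + (↑u⁻¹ : A) • δ (u : A) = δ 1) :
    (∀ a b : A, δ (a * b + b * a) = (2 : ℂ) • (a • δ b) + (2 : ℂ) • (b • δ a)) ∧
      (∀ t : A, δ (t * t) = (2 : ℂ) • (t • δ t)) := by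
  have h1 : δ 1 = 0 := map_one_eq_zero_of_unit_identity δ.toAddMonoidHom h
  have hsq : ∀ t : A, δ (t * t) = t • δ t + t • δ t := by
    intro t
    obtain ⟨k, ⟨u, hu⟩, ⟨v, hv⟩⟩ := exists_isUnit_algebraMap_sub_and_sub_one t
    have key : δ ((u : A) * u) = (u : A) • δ (u : A) + (u : A) • δ (u : A) :=
      map_mul_self_of_add_eq_one δ.toAddMonoidHom h u v (by rw [hu, hv]; abel)
    have hδu : δ (u : A) = -δ t := by
      rw [hu, map_sub, Algebra.algebraMap_eq_smul_one, map_smul, h1, smul_zero, zero_sub]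
    have hexp : (u : A) * u = (k * k) • (1 : A) - k • t - k • t + t * t := by
      rw [hu, Algebra.algebraMap_eq_smul_one]
      simp only [sub_mul, mul_sub, smul_mul_assoc, mul_smul_comm, one_mul, mul_one, smul_sub,
        smul_smul]
      abel
    rw [hδu, hexp, hu] at key
    simp only [map_add, map_sub, map_smul, h1, smul_zero, sub_smul, smul_neg,
      algebraMap_smul] at key
    rw [← sub_eq_zero] at key ⊢
    rw [← key]
    abel
  refine ⟨fun a b => ?_, fun t => by rw [hsq, two_smul]⟩
  have hab := hsq (a + b)
  simp only [add_mul, mul_add, map_add, add_smul, smul_add, hsq a, hsq b] at hab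
  rw [map_add, two_smul, two_smul]
  rw [← sub_eq_zero] at hab ⊢
  rw [← hab]
  abel
end

section
/- Let δ : 𝒜 → ℳ be a (not necessarily continuous) linear map and let C be a nonzero element of 𝒜. If δ is left derivable at C, then the map C·δ : A ↦ C δ(A) is a Jordan left derivation; that is, C δ(AB + BA) = 2A(C δ(B)) + 2B(C δ(A)) for all A, B ∈ 𝒜. -/
/-- If additive maps `g`, `f` satisfy `f u⁻¹ = -u⁻² g u` on units and `g 1 = 0`, then
`g (u²) = 2 u g u` whenever `u` and `1 - u` are units (a Hua-type identity). -/
theorem map_mul_self_of_map_units_inv {R M : Type*} [Ring R] [AddCommGroup M] [Module R M]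
    (g f : R →+ M) (hg : g 1 = 0)
    (hf : ∀ u : Rˣ, f ↑u⁻¹ = -(((↑u⁻¹ * ↑u⁻¹ : R)) • g u))
    (u v : Rˣ) (huv : (u : R) + v = 1) :
    g (u * u) = (u : R) • g u + (u : R) • g u := by
  have hv : (v : R) = 1 - u := eq_sub_of_add_eq' huv
  have hcomm : u * v = v * u := by
    ext
    simp only [Units.val_mul, hv]
    noncomm_ring
  have hsum : (↑u⁻¹ + ↑v⁻¹ : R) = ↑(u * v)⁻¹ := by
    have h₁ : (↑(u * v)⁻¹ : R) * (v + u) = ↑u⁻¹ + ↑v⁻¹ := by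
      rw [mul_add, ← Units.val_mul, ← Units.val_mul, mul_inv_rev]
      nth_rewrite 1 [← mul_inv_rev, hcomm, mul_inv_rev]
      simp
    rw [← h₁, add_comm (v : R), huv, mul_one]
  have key : f ↑u⁻¹ + f ↑v⁻¹ = f ↑(u * v)⁻¹ := by rw [← map_add, hsum]
  have hgv : g v = -g u := by rw [hv, map_sub, hg, zero_sub]
  have hguv : g ↑(u * v) = g u - g (u * u) := by
    rw [Units.val_mul, hv, mul_sub, mul_one, map_sub]
  rw [hf, hf, hf, hgv, hguv] at key
  have e₁ : (u * v) * (u * v) * (u⁻¹ * u⁻¹) = v * v := by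
    rw [hcomm]
    nth_rewrite 1 [← hcomm]
    rw [show u * v * (v * u) * (u⁻¹ * u⁻¹) = u * (v * v) * u⁻¹ by group,
      ← mul_assoc u, hcomm, mul_assoc v, hcomm]
    group
  have e₂ : (u * v) * (u * v) * (v⁻¹ * v⁻¹) = u * u := by
    nth_rewrite 2 [hcomm]
    rw [show u * v * (v * u) * (v⁻¹ * v⁻¹) = u * v * v * (u * v⁻¹) * v⁻¹ by group]
    rw [show u * v⁻¹ = v⁻¹ * u by
      rw [eq_inv_mul_iff_mul_eq, ← mul_assoc, ← hcomm, mul_inv_cancel_right]]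
    rw [show u * v * v * (v⁻¹ * u) * v⁻¹ = u * (v * u) * v⁻¹ by group, ← hcomm]
    group
  have e₃ : (u * v) * (u * v) * ((u * v)⁻¹ * (u * v)⁻¹) = 1 := by group
  have key' := congrArg (fun m => (↑((u * v) * (u * v)) : R) • m) key
  simp only [smul_add, smul_neg, neg_neg, ← Units.val_mul, smul_smul, e₁, e₂, e₃] at key'
  simp only [Units.val_mul, Units.val_one, one_smul, hv] at key'
  have hexp : ((1 - u : R) * (1 - u)) • g u
      = g u - ((u : R) • g u + (u : R) • g u) + ((u : R) * u) • g u := by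
    rw [show (1 - u : R) * (1 - u) = 1 - (u + u) + u * u by noncomm_ring]
    simp only [add_smul, sub_smul, one_smul]
  rw [hexp] at key'
  have : g u - g (u * u) = g u - ((u : R) • g u + (u : R) • g u) := by
    have h₂ := congrArg Neg.neg key'
    rw [neg_neg] at h₂
    rw [← h₂]
    abel
  exact sub_right_injective this

/-- If `δ` is left derivable at a nonzero point `C`, then `C·δ` is a Jordan left
derivation. -/
theorem stmt_1
    {A : Type*} [NormedRing A] [NormedAlgebra ℂ A] [CompleteSpace A]
    {M : Type*} [AddCommGroup M] [Module ℂ M] [Module A M] [IsScalarTower ℂ A M]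
    (δ : A →ₗ[ℂ] M) (C : A) (hC : C ≠ 0)
    (h : ∀ a b : A, a * b = C → δ (a * b) = a • δ b + b • δ a) :
    ∀ a b : A,
      C • δ (a * b + b * a) = (2 : ℂ) • (a • (C • δ b)) + (2 : ℂ) • (b • (C • δ a)) := by
  have : SMulCommClass ℂ A M := IsScalarTower.to_smulCommClass
  have hone : C • δ 1 = 0 := by simpa using h 1 C (one_mul C)
  let g : A →+ M :=
    { toFun := fun x => C • δ x
      map_zero' := by simp
      map_add' := fun x y => by simp }
  let f : A →+ M :=
    { toFun := fun x => δ (x * C) - x • δ C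
      map_zero' := by simp
      map_add' := fun x y => by simp only [add_mul, map_add, add_smul]; abel }
  have hf : ∀ u : Aˣ, f ↑u⁻¹ = -((↑u⁻¹ * ↑u⁻¹ : A) • g u) := by
    intro u
    have hu := h u (↑u⁻¹ * C) (Units.mul_inv_cancel_left u C)
    rw [Units.mul_inv_cancel_left] at hu
    change δ (↑u⁻¹ * C) - (↑u⁻¹ : A) • δ C = -((↑u⁻¹ * ↑u⁻¹ : A) • C • δ u)
    rw [hu, smul_add, smul_smul, Units.inv_mul, one_smul, smul_smul, smul_smul, mul_assoc]
    abel
  have hsq : ∀ a : A, C • δ (a * a) = a • (C • δ a) + a • (C • δ a) := by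
    intro a
    have hunit : ∀ t : ℝ, ‖a‖ * ‖(1 : A)‖ < t → IsUnit (algebraMap ℂ A t - a) := by
      intro t ht
      refine spectrum.mem_resolventSet_iff.mp (spectrum.mem_resolventSet_of_norm_lt_mul ?_)
      rw [Complex.norm_real]
      exact ht.trans_le (le_abs_self t)
    obtain ⟨u, hu⟩ := (hunit (‖a‖ * ‖(1 : A)‖ + 1) (by linarith)).neg
    obtain ⟨v, hv⟩ := hunit (‖a‖ * ‖(1 : A)‖ + 1 + 1) (by linarith)
    generalize ‖a‖ * ‖(1 : A)‖ + 1 = t at hu hv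
    have huv : (u : A) + v = 1 := by
      rw [hu, hv, Complex.ofReal_add, map_add, Complex.ofReal_one, map_one]
      abel
    have hmain := map_mul_self_of_map_units_inv g f hone hf u v huv
    change C • δ (u * u) = (u : A) • (C • δ u) + (u : A) • (C • δ u) at hmain
    have hu' : (u : A) = a - (t : ℂ) • (1 : A) := by
      rw [hu, neg_sub, Algebra.algebraMap_eq_smul_one]
    have hδu : C • δ u = C • δ a := by
      rw [hu', map_sub, map_smul, smul_sub, smul_comm C, hone, smul_zero, sub_zero]
    have hu2 : (u * u : A) = a * a - (t : ℂ) • a - (t : ℂ) • a + ((t : ℂ) * t) • (1 : A) := by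
      simp only [hu', sub_mul, mul_sub, smul_mul_assoc, mul_smul_comm, one_mul, mul_one, mul_smul,
        smul_sub]
      abel
    rw [hδu, hu2, hu'] at hmain
    simp only [map_add, map_sub, map_smul, smul_add, smul_sub, sub_smul, smul_comm C, hone,
      smul_zero, add_zero, smul_assoc, one_smul] at hmain
    have h₁ := congrArg (fun m => m + (t : ℂ) • C • δ a + (t : ℂ) • C • δ a) hmain
    calc C • δ (a * a) = _ := by abel
      _ = _ := h₁
      _ = _ := by abel
  intro a b
  have hab := hsq (a + b)
  simp only [add_mul, mul_add, map_add, smul_add, add_smul, hsq a, hsq b] at hab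
  rw [map_add, smul_add, two_smul, two_smul]
  have h₁ := congrArg (fun m => m - (a • C • δ a + a • C • δ a) - (b • C • δ b + b • C • δ b)) hab
  calc C • δ (a * b) + C • δ (b * a) = _ := by abel
    _ = _ := h₁
    _ = _ := by abel
end

section
/- Let δ : 𝒜 → ℳ be a (not necessarily continuous) linear map and let C be a nonzero element of the centre Z(𝒜) of 𝒜. If δ is Jordan left derivable at C, then the map C·δ : A ↦ C δ(A) is a Jordan left derivation; that is, C δ(AB + BA) = 2A(C δ(B)) + 2B(C δ(A)) for all A, B ∈ 𝒜. -/
/-- A complex number `z` exists such that both `a + z` and `1 - (a + z)` are invertible. -/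
theorem exists_isUnit_add_algebraMap {A : Type*} [NormedRing A] [NormedAlgebra ℂ A]
    [CompleteSpace A] (a : A) :
    ∃ z : ℂ, IsUnit (a + algebraMap ℂ A z) ∧ IsUnit (1 - (a + algebraMap ℂ A z)) := by
  have large (r : ℝ) (hr : ‖a‖ * ‖(1 : A)‖ < |r|) : IsUnit (algebraMap ℂ A (r : ℂ) - a) := by
    by_contra hu
    have hs : (r : ℂ) ∈ spectrum ℂ a := hu
    have := spectrum.norm_le_norm_mul_of_mem hs
    rw [Complex.norm_real, Real.norm_eq_abs] at this
    linarith
  have hnn : 0 ≤ ‖a‖ * ‖(1 : A)‖ := by positivity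
  refine ⟨((‖a‖ * ‖(1 : A)‖ + 2 : ℝ) : ℂ), ?_, ?_⟩
  · have := (large (-(‖a‖ * ‖(1 : A)‖ + 2)) (by rw [abs_neg, abs_of_pos] <;> linarith)).neg
    convert this using 1
    rw [Complex.ofReal_neg, map_neg]
    abel
  · convert large (1 - (‖a‖ * ‖(1 : A)‖ + 2))
      (by rw [abs_of_neg] <;> linarith) using 1
    rw [Complex.ofReal_sub, map_sub, Complex.ofReal_one, map_one]
    abel

/-- If `F` and `g` are additive maps linked by `u² F(u⁻¹) + g(u) = u d` on invertible elements and
`g 1 = 0`, then `g (t²) = 2 t g(t)` whenever `t` and `1 - t` are invertible. -/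
theorem map_mul_self_of_inv_identity {R M : Type*} [Ring R] [AddCommGroup M] [Module R M]
    (F g : R →+ M) (d : M) (hg : g 1 = 0)
    (hF : ∀ u : Rˣ, (u * u : R) • F (↑u⁻¹) + g u = (u : R) • d)
    {t : R} (ht : IsUnit t) (ht' : IsUnit (1 - t)) :
    g (t * t) = t • g t + t • g t := by
  obtain ⟨u, rfl⟩ := ht
  obtain ⟨v, hv⟩ := ht'
  have hinv : ((v * u)⁻¹ : Rˣ) = (↑u⁻¹ + ↑v⁻¹ : R) := by
    rw [mul_inv_rev, Units.val_mul]
    calc (↑u⁻¹ * ↑v⁻¹ : R) = ↑u⁻¹ * (v + u) * ↑v⁻¹ := by rw [hv]; simp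
      _ = _ := by simp [mul_add, add_mul, mul_assoc]
  have hu := hF u
  have hv' := hF v
  have hw := hF (v * u)
  rw [hinv, map_add, Units.val_mul, smul_add] at hw
  have e₁ : (v * u * (v * u) : R) = v * v * (u * u) := by rw [hv]; noncomm_ring
  have e₂ : (v * u * (v * u) : R) = u * u * (v * v) := by rw [hv]; noncomm_ring
  have e₃ : (v * u : R) = v * v * u + u * u * v := by rw [hv]; noncomm_ring
  nth_rw 1 [e₁] at hw
  rw [e₂, mul_smul (v * v : R), mul_smul (u * u : R), eq_sub_of_add_eq hu, eq_sub_of_add_eq hv'] at hw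
  nth_rw 2 [e₃] at hw
  simp only [hv, map_sub, hg, sub_mul, mul_sub, one_mul, mul_one, smul_sub, sub_smul, add_smul,
    mul_smul, one_smul, smul_zero] at hw
  rw [← sub_eq_zero] at hw ⊢
  rw [← neg_eq_zero, ← hw]
  abel

/-- If `δ` is Jordan left derivable at a nonzero central point `C`, then `C·δ` is a
Jordan left derivation. -/
theorem stmt_2
    {A : Type*} [NormedRing A] [NormedAlgebra ℂ A] [CompleteSpace A]
    {M : Type*} [AddCommGroup M] [Module ℂ M] [Module A M] [IsScalarTower ℂ A M]
    (δ : A →ₗ[ℂ] M) (C : A) (hC : C ≠ 0) (hZ : ∀ b : A, C * b = b * C)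
    (h : ∀ a b : A, a * b + b * a = C →
      δ (a * b + b * a) = (2 : ℂ) • (a • δ b) + (2 : ℂ) • (b • δ a)) :
    ∀ a b : A,
      C • δ (a * b + b * a) = (2 : ℂ) • (a • (C • δ b)) + (2 : ℂ) • (b • (C • δ a)) := by
  have key (u : Aˣ) : (u : A) • δ (↑u⁻¹ * C) + (↑u⁻¹ * C : A) • δ u = δ C := by
    have e : (u : A) * ((2⁻¹ : ℂ) • (↑u⁻¹ * C)) + ((2⁻¹ : ℂ) • (↑u⁻¹ * C)) * u = C := by
      rw [mul_smul_comm, smul_mul_assoc, mul_assoc (↑u⁻¹ : A), hZ u, Units.mul_inv_cancel_left,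
        Units.inv_mul_cancel_left, ← add_smul]
      norm_num
    have := h _ _ e
    rw [e, map_smul, smul_comm (u : A) (2⁻¹ : ℂ), smul_assoc, smul_smul, smul_smul] at this
    simpa using this.symm
  let F : A →+ M := δ.toAddMonoidHom.comp (AddMonoidHom.mulRight C)
  let g : A →+ M := (DistribSMul.toAddMonoidHom M C).comp δ.toAddMonoidHom
  have hg (a : A) : g a = C • δ a := rfl
  have hg1 : g 1 = 0 := by simpa [hg] using key 1
  have hF (u : Aˣ) : (u * u : A) • F (↑u⁻¹) + g u = (u : A) • δ C := by
    rw [← key u, smul_add, smul_smul, smul_smul, Units.mul_inv_cancel_left]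
    rfl
  have hgz (z : ℂ) (a : A) : g (z • a) = z • g a := by
    rw [hg, hg, map_smul, smul_comm]
  have hsq (a : A) : g (a * a) = a • g a + a • g a := by
    obtain ⟨z, hz, hz'⟩ := exists_isUnit_add_algebraMap a
    have := map_mul_self_of_inv_identity F g (δ C) hg1 hF hz hz'
    have e : (a + algebraMap ℂ A z) * (a + algebraMap ℂ A z)
        = a * a + (z • a + z • a) + (z * z) • 1 := by
      simp only [Algebra.algebraMap_eq_smul_one, mul_add, add_mul, smul_mul_assoc, mul_smul_comm,
        one_mul, mul_one, smul_add, smul_smul, add_assoc]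
    rw [e, Algebra.algebraMap_eq_smul_one] at this
    simp only [map_add, hgz, hg1, smul_zero, add_zero, add_smul, smul_assoc, one_smul] at this
    rw [← sub_eq_zero] at this ⊢
    rw [← this]
    abel
  intro a b
  have hab := hsq (a + b)
  simp only [mul_add, add_mul, map_add, hsq, smul_add, add_smul] at hab
  rw [← hg, ← hg, ← hg, two_smul, two_smul, map_add]
  rw [← sub_eq_zero] at hab ⊢
  rw [← hab]
  abel
end

section
/- Let δ : 𝒜 → ℳ be a (not necessarily continuous) linear map. Then the following are equivalent: (i) δ is a Jordan left derivation; (ii) δ is left derivable at I; (iii) δ is Jordan left derivable at I. -/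
section JordanLeft

variable {A : Type*} [NormedRing A] [NormedAlgebra ℂ A]
  {M : Type*} [AddCommGroup M] [Module ℂ M] [Module A M]

theorem jordan_left_of_sq (δ : A →ₗ[ℂ] M) (h : ∀ a : A, δ (a * a) = (2 : ℂ) • (a • δ a))
    (a b : A) : δ (a * b + b * a) = (2 : ℂ) • (a • δ b) + (2 : ℂ) • (b • δ a) := by
  have hab := h (a + b)
  rw [show (a + b) * (a + b) = a * a + (a * b + b * a) + b * b by noncomm_ring] at hab
  simp only [map_add δ (a * a + (a * b + b * a)), map_add δ (a * a), map_add δ a b, h a, h b,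
    add_smul, smul_add] at hab
  rw [← sub_eq_zero] at hab ⊢
  rw [← hab]
  abel

/-- An idempotent is annihilated by a Jordan left derivation. -/
theorem jordan_left_map_idempotent (δ : A →ₗ[ℂ] M)
    (h : ∀ a b : A, δ (a * b + b * a) = (2 : ℂ) • (a • δ b) + (2 : ℂ) • (b • δ a))
    {p : A} (hp : p * p = p) : δ p = 0 := by
  have h1 := h p p
  rw [hp, map_add, ← two_smul ℂ (δ p), ← smul_add] at h1
  have h2 : δ p = p • δ p + p • δ p := smul_right_injective M (two_ne_zero (α := ℂ)) h1
  have h3 : p • δ p = 0 := by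
    have h4 := congrArg (p • ·) h2
    simp only [smul_add, smul_smul, hp] at h4
    simpa using h4.symm
  rw [h2, h3, add_zero]

theorem jordan_left_of_mul_eq_one (δ : A →ₗ[ℂ] M)
    (h : ∀ a b : A, δ (a * b + b * a) = (2 : ℂ) • (a • δ b) + (2 : ℂ) • (b • δ a))
    {a b : A} (hab : a * b = 1) : δ (a * b) = a • δ b + b • δ a := by
  have h1 : δ (a * b) = 0 := jordan_left_map_idempotent δ h (by rw [hab, one_mul])
  have h2 : δ (b * a) = 0 := jordan_left_map_idempotent δ h (by
    rw [mul_assoc, ← mul_assoc a b a, hab, one_mul])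
  have h3 := h a b
  rw [map_add, h1, h2, add_zero, ← smul_add] at h3
  rw [h1]
  exact ((smul_eq_zero.mp h3.symm).resolve_left two_ne_zero).symm

theorem map_one_of_inverse_pairs (δ : A →ₗ[ℂ] M)
    (h : ∀ a b : A, a * b = 1 → b * a = 1 → a • δ b + b • δ a = 0) : δ 1 = 0 := by
  have := h 1 1 (one_mul 1) (one_mul 1)
  rw [one_smul, ← two_smul ℂ] at this
  exact (smul_eq_zero.mp this).resolve_left two_ne_zero

/-- Hua-type identity: the Jordan rule holds at `a` when `a` and `1 - a` are invertible. -/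
theorem map_sq_of_units (δ : A →ₗ[ℂ] M)
    (h : ∀ a b : A, a * b = 1 → b * a = 1 → a • δ b + b • δ a = 0)
    {a b c : A} (hab : a * b = 1) (hba : b * a = 1)
    (hac : (1 - a) * c = 1) (hca : c * (1 - a) = 1) :
    δ (a * a) = a • δ a + a • δ a := by
  have h1 := map_one_of_inverse_pairs δ h
  have hbc : b * c = b + c := by
    calc b * c = b * ((1 - a) + a) * c := by rw [sub_add_cancel, mul_one]
      _ = b * ((1 - a) * c) + (b * a) * c := by noncomm_ring
      _ = b + c := by rw [hac, hba, mul_one, one_mul]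
  have hcomm : (1 - a) * a = a * (1 - a) := by noncomm_ring
  have e := h (a * (1 - a)) (b * c)
    (by rw [← hcomm, mul_assoc, ← mul_assoc a b c, hab, one_mul, hac])
    (by rw [← hcomm, mul_assoc, ← mul_assoc c, hca, one_mul, hba])
  have ea := h a b hab hba
  have ec := h (1 - a) c hac hca
  rw [map_sub, h1, zero_sub, smul_neg] at ec
  have e' := congrArg ((a * (1 - a)) • ·) e
  have hinv : (a * (1 - a)) * (b * c) = 1 := by
    rw [← hcomm, mul_assoc, ← mul_assoc a b c, hab, one_mul, hac]
  have ea' : (a * a) • δ b = - δ a := by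
    have := congrArg (a • ·) ea
    simp only [smul_add, smul_smul, hab, one_smul, smul_zero] at this
    exact eq_neg_of_add_eq_zero_left this
  have ec' : ((1 - a) * (1 - a)) • δ c = δ a := by
    have := congrArg ((1 - a) • ·) ec
    simp only [smul_add, smul_neg, smul_smul, hac, one_smul, smul_zero] at this
    exact (add_neg_eq_zero.mp this)
  simp only [smul_add, smul_smul, hinv, one_smul, smul_zero] at e'
  rw [hbc, map_add, smul_add,
    show a * (1 - a) * (a * (1 - a)) = ((1 - a) * (1 - a)) * (a * a) by noncomm_ring,
    mul_smul _ (a * a), ea',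
    show ((1 - a) * (1 - a)) * (a * a) = (a * a) * ((1 - a) * (1 - a)) by noncomm_ring,
    mul_smul _ _ (δ c), ec',
    show (1 - a) * (1 - a) = 1 - a - a + a * a by noncomm_ring,
    show a * (1 - a) = a - a * a by noncomm_ring, map_sub] at e'
  simp only [add_smul, sub_smul, smul_neg, one_smul] at e'
  rw [← sub_eq_zero] at e' ⊢
  rw [← neg_eq_zero, ← e']
  abel

variable [CompleteSpace A] [IsScalarTower ℂ A M]

/-- A linear map that satisfies the left derivation rule on pairs of mutually inverse elements is
a Jordan left derivation. -/
theorem jordan_left_of_inverse_pairs (δ : A →ₗ[ℂ] M)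
    (h : ∀ a b : A, a * b = 1 → b * a = 1 → a • δ b + b • δ a = 0) (a b : A) :
    δ (a * b + b * a) = (2 : ℂ) • (a • δ b) + (2 : ℂ) • (b • δ a) := by
  refine jordan_left_of_sq δ (fun t => ?_) a b
  have h1 := map_one_of_inverse_pairs δ h
  obtain ⟨k, hk, hk'⟩ : ∃ k : ℂ, k ∈ resolventSet ℂ t ∧ 1 + k ∈ resolventSet ℂ t := by
    have hr : 0 ≤ ‖t‖ * ‖(1 : A)‖ := by positivity
    refine ⟨((‖t‖ * ‖(1 : A)‖ + 1 : ℝ) : ℂ), spectrum.mem_resolventSet_of_norm_lt_mul ?_,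
      spectrum.mem_resolventSet_of_norm_lt_mul ?_⟩
    · rw [Complex.norm_real, Real.norm_of_nonneg (by linarith)]
      linarith
    · rw [← Complex.ofReal_one, ← Complex.ofReal_add, Complex.norm_real,
        Real.norm_of_nonneg (by linarith)]
      linarith
  rw [spectrum.mem_resolventSet_iff] at hk hk'
  have hu : IsUnit (t - algebraMap ℂ A k) := by simpa using hk.neg
  have hv : IsUnit (1 - (t - algebraMap ℂ A k)) := by
    convert hk' using 1
    rw [map_add, map_one]
    abel
  obtain ⟨u, hu⟩ := hu
  obtain ⟨v, hv⟩ := hv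
  have key := map_sq_of_units δ h (a := t - algebraMap ℂ A k) (b := ↑u⁻¹) (c := ↑v⁻¹)
    (by rw [← hu, u.mul_inv]) (by rw [← hu, u.inv_mul])
    (by rw [← hv, v.mul_inv]) (by rw [← hv, v.inv_mul])
  have hsq : (t - algebraMap ℂ A k) * (t - algebraMap ℂ A k)
      = t * t - k • t - k • t + (k * k) • (1 : A) := by
    simp only [Algebra.algebraMap_eq_smul_one, sub_mul, mul_sub, smul_mul_assoc, mul_smul_comm,
      one_mul, mul_one, smul_sub, mul_smul]
    abel
  rw [hsq, Algebra.algebraMap_eq_smul_one] at key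
  simp only [map_add, map_sub, map_smul, h1, smul_zero, add_zero, sub_zero, sub_smul,
    smul_assoc, one_smul] at key
  rw [two_smul, ← sub_eq_zero, ← sub_eq_zero.mpr key]
  abel

end JordanLeft


/-- `δ` is a Jordan left derivation iff `δ` is left derivable at `1` iff `δ` is
Jordan left derivable at `1`. -/
theorem stmt_3
    {A : Type*} [NormedRing A] [NormedAlgebra ℂ A] [CompleteSpace A]
    {M : Type*} [AddCommGroup M] [Module ℂ M] [Module A M] [IsScalarTower ℂ A M]
    (δ : A →ₗ[ℂ] M) :
    ((∀ a b : A, δ (a * b + b * a) = (2 : ℂ) • (a • δ b) + (2 : ℂ) • (b • δ a)) ↔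
        (∀ a b : A, a * b = 1 → δ (a * b) = a • δ b + b • δ a)) ∧
      ((∀ a b : A, δ (a * b + b * a) = (2 : ℂ) • (a • δ b) + (2 : ℂ) • (b • δ a)) ↔
        (∀ a b : A, a * b + b * a = 1 →
          δ (a * b + b * a) = (2 : ℂ) • (a • δ b) + (2 : ℂ) • (b • δ a))) := by
  have : SMulCommClass ℂ A M := IsScalarTower.to_smulCommClass
  refine ⟨⟨fun h a b hab => jordan_left_of_mul_eq_one δ h hab, fun h => ?_⟩,
    ⟨fun h a b _ => h a b, fun h => ?_⟩⟩
  · have h1 : δ 1 = 0 := by simpa using h 1 1 (one_mul 1)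
    refine jordan_left_of_inverse_pairs δ fun a b hab _ => ?_
    rw [← h a b hab, hab, h1]
  · have half : ∀ a b : A, a * b = 1 → b * a = 1 → δ 1 = a • δ b + b • δ a := by
      intro a b hab hba
      have hs : a * ((2 : ℂ)⁻¹ • b) + ((2 : ℂ)⁻¹ • b) * a = 1 := by
        rw [mul_smul_comm, smul_mul_assoc, hab, hba, ← add_smul]
        norm_num
      have := h a ((2 : ℂ)⁻¹ • b) hs
      rw [hs, map_smul, smul_comm a, smul_assoc, smul_smul, smul_smul] at this
      simpa using this
    have h1 : δ 1 = 0 := by simpa using half 1 1 (one_mul 1) (one_mul 1)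
    refine jordan_left_of_inverse_pairs δ fun a b hab hba => ?_
    rw [← half a b hab hba, h1]
end

section
/- Let δ : 𝒜 → ℳ be a (not necessarily continuous) linear map, and let X, Y ∈ 𝒜 with X + Y = I. If δ is left derivable at X and left derivable at Y, then δ is a Jordan left derivation. -/
section JordanLeft

variable {A M : Type*} [Ring A] [AddCommGroup M] [Module A M]

/-- Adding the product rules for `u * (u⁻¹ * X)` and `u * (u⁻¹ * Y)`, where `X + Y = 1`, gives the
product rule for `u * u⁻¹`. -/
theorem map_one_eq_of_leftDerivable (δ : A →+ M) {X Y : A} (hXY : X + Y = 1)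
    (hX : ∀ a b : A, a * b = X → δ (a * b) = a • δ b + b • δ a)
    (hY : ∀ a b : A, a * b = Y → δ (a * b) = a • δ b + b • δ a) (u : Aˣ) :
    δ 1 = (u : A) • δ (↑u⁻¹ : A) + (↑u⁻¹ : A) • δ (u : A) := by
  have h1 := hX u (↑u⁻¹ * X) (by simp)
  have h2 := hY u (↑u⁻¹ * Y) (by simp)
  rw [Units.mul_inv_cancel_left] at h1 h2
  have hu : (↑u⁻¹ : A) = ↑u⁻¹ * X + ↑u⁻¹ * Y := by rw [← mul_add, hXY, mul_one]
  rw [← hXY, map_add, h1, h2, add_add_add_comm, ← smul_add, ← map_add, ← add_smul, ← hu]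

/-- Hua's identity turns the product rule for inverses into the rule for squares. -/
theorem map_mul_self_of_isUnit (δ : A →+ M)
    (h : ∀ u : Aˣ, δ 1 = (u : A) • δ (↑u⁻¹ : A) + (↑u⁻¹ : A) • δ (u : A))
    {b : A} (hb : IsUnit b) (hb' : IsUnit (1 - b)) :
    δ (b * b) = (2 * b) • δ b := by
  have h1 : δ 1 = 0 := by simpa using h 1
  have hsq (u : Aˣ) : ((u : A) * u) • δ (↑u⁻¹ : A) = -δ (u : A) := by
    have hu := congrArg (fun m => (u : A) • m) (h u)
    simp only [h1, smul_add, smul_smul, Units.mul_inv, one_smul, smul_zero] at hu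
    exact eq_neg_of_add_eq_zero_left hu.symm
  obtain ⟨u, rfl⟩ := hb
  obtain ⟨v, hv⟩ := hb'
  have hua : (↑(u * v)⁻¹ : A) = ↑u⁻¹ + ↑v⁻¹ := by
    have : (↑v⁻¹ : A) * (u + v) * ↑u⁻¹ = ↑u⁻¹ + ↑v⁻¹ := by
      simp [mul_add, add_mul, add_comm]
    rw [← this, hv]
    simp
  have key := hsq (u * v)
  have e1 : ((u * v : Aˣ) : A) * (u * v : Aˣ) = (v * v) * (u * u) := by
    push_cast
    simp only [hv]; noncomm_ring
  have e2 : ((u * v : Aˣ) : A) * (u * v : Aˣ) = (u * u) * (v * v) := by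
    push_cast
    simp only [hv]; noncomm_ring
  have hδ : δ (v : A) = -δ (u : A) := by rw [hv, map_sub, h1, zero_sub]
  have hprod : δ ((u * v : Aˣ) : A) = δ (u : A) - δ (u * u : A) := by
    rw [← map_sub, Units.val_mul, hv, mul_sub, mul_one]
  rw [hua, map_add, smul_add, hprod] at key
  nth_rw 1 [e1] at key
  rw [e2, mul_smul (v * v : A), mul_smul (u * u : A), hsq, hsq, hδ] at key
  have hc : (2 * u : A) = 1 - v * v + u * u := by rw [hv]; noncomm_ring
  rw [hc, add_smul, sub_smul, one_smul]
  simp only [smul_neg, neg_neg, neg_sub] at key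
  rw [sub_eq_iff_eq_add.mp key.symm]
  abel

end JordanLeft

/-- In a Banach algebra every element is a large scalar minus an element `b` for which both `b` and
`1 - b` are invertible, so the rule for squares extends to all elements. -/
theorem map_mul_self_of_forall_units
    {A : Type*} [NormedRing A] [NormedAlgebra ℂ A] [CompleteSpace A]
    {M : Type*} [AddCommGroup M] [Module ℂ M] [Module A M] [IsScalarTower ℂ A M]
    (δ : A →ₗ[ℂ] M)
    (h : ∀ u : Aˣ, δ 1 = (u : A) • δ (↑u⁻¹ : A) + (↑u⁻¹ : A) • δ (u : A)) (a : A) :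
    δ (a * a) = (2 * a) • δ a := by
  have h1 : δ 1 = 0 := by simpa using h 1
  have hpos : 0 ≤ ‖a‖ * ‖(1 : A)‖ := by positivity
  obtain ⟨t, ht⟩ : ∃ t : ℝ, t = ‖a‖ * ‖(1 : A)‖ + 2 := ⟨_, rfl⟩
  have hres (s : ℝ) (hs : ‖a‖ * ‖(1 : A)‖ < s) : IsUnit ((s : ℂ) • (1 : A) - a) := by
    rw [← Algebra.algebraMap_eq_smul_one]
    refine spectrum.mem_resolventSet_of_norm_lt_mul ?_
    rwa [Complex.norm_real, Real.norm_of_nonneg (hpos.trans hs.le)]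
  have hb := hres t (by linarith)
  have hb' : IsUnit (1 - ((t : ℂ) • (1 : A) - a)) := by
    have := (hres (t - 1) (by linarith)).neg
    convert this using 1
    push_cast
    rw [sub_smul, one_smul]
    abel
  have key := map_mul_self_of_isUnit δ.toAddMonoidHom h hb hb'
  simp only [LinearMap.toAddMonoidHom_coe] at key
  have hsq : ((t : ℂ) • (1 : A) - a) * ((t : ℂ) • (1 : A) - a)
      = (t * t : ℂ) • (1 : A) - (2 * t : ℂ) • a + a * a := by
    simp only [sub_mul, mul_sub, smul_mul_assoc, mul_smul_comm, one_mul, mul_one, smul_sub,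
      mul_smul, two_smul]
    abel
  rw [hsq, map_add, map_sub, map_sub, map_smul, map_smul, map_smul, h1, smul_zero, smul_zero,
    zero_sub, zero_sub, mul_sub, sub_smul, mul_smul_comm, mul_one, smul_neg, smul_neg,
    smul_assoc, ofNat_smul_eq_nsmul] at key
  have e : (2 * t : ℂ) • δ a = (t : ℂ) • (2 : ℕ) • δ a := by
    rw [two_nsmul, two_mul, add_smul, smul_add]
  rw [e, sub_neg_eq_add] at key
  exact add_left_cancel key


/-- If `X + Y = 1` and `δ` is left derivable at `X` and at `Y`, then `δ` is a
Jordan left derivation. -/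
theorem stmt_4
    {A : Type*} [NormedRing A] [NormedAlgebra ℂ A] [CompleteSpace A]
    {M : Type*} [AddCommGroup M] [Module ℂ M] [Module A M] [IsScalarTower ℂ A M]
    (δ : A →ₗ[ℂ] M) (X Y : A) (hXY : X + Y = 1)
    (hX : ∀ a b : A, a * b = X → δ (a * b) = a • δ b + b • δ a)
    (hY : ∀ a b : A, a * b = Y → δ (a * b) = a • δ b + b • δ a) :
    ∀ a b : A, δ (a * b + b * a) = (2 : ℂ) • (a • δ b) + (2 : ℂ) • (b • δ a) := by
  have hsq := map_mul_self_of_forall_units δ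
    (map_one_eq_of_leftDerivable δ.toAddMonoidHom hXY hX hY)
  intro a b
  have e : a * b + b * a = (a + b) * (a + b) - a * a - b * b := by noncomm_ring
  rw [e, map_sub, map_sub, hsq, hsq, hsq, map_add]
  simp only [two_mul, add_smul, smul_add, two_smul]
  abel
end

section
/- Let δ : 𝒜 → ℳ be a (not necessarily continuous) linear map, and let X, Y be elements of the centre Z(𝒜) of 𝒜 with X + Y = I. Then δ is a Jordan left derivation if and only if δ is Jordan left derivable at X and Jordan left derivable at Y. -/
section JordanLeftDerivable

variable {A : Type*} [Ring A] [Algebra ℂ A]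
  {M : Type*} [AddCommGroup M] [Module ℂ M] [Module A M] [IsScalarTower ℂ A M]

/-- A linear map that is Jordan left derivable at a central `X` and kills `1` has a prescribed
value at `t⁻¹ X`. -/
theorem map_inv_mul_of_jordanLeftDerivableAt (δ : A →ₗ[ℂ] M) {X : A}
    (hXc : ∀ b : A, X * b = b * X)
    (hX : ∀ a b : A, a * b + b * a = X →
      δ (a * b + b * a) = (2 : ℂ) • (a • δ b) + (2 : ℂ) • (b • δ a))
    {t s : A} (hts : t * s = 1) (hst : s * t = 1) :
    δ (s * X) = s • δ X - (s * s * X) • δ t := by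
  have e : t * ((2⁻¹ : ℂ) • (s * X)) + ((2⁻¹ : ℂ) • (s * X)) * t = X := by
    rw [mul_smul_comm, smul_mul_assoc, mul_assoc s X t, hXc t, ← mul_assoc, ← mul_assoc, hts,
      hst, one_mul, ← add_smul]
    norm_num
  have h := hX _ _ e
  have : SMulCommClass ℂ A M := IsScalarTower.to_smulCommClass
  rw [e, map_smul, smul_comm t, smul_assoc, smul_smul, smul_smul] at h
  norm_num at h
  rw [h, smul_add, smul_smul, hst, one_smul, smul_smul, mul_assoc, add_sub_cancel_right]

theorem map_one_of_jordanLeftDerivableAt (δ : A →ₗ[ℂ] M) {X Y : A} (hXY : X + Y = 1)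
    (hX : ∀ a b : A, a * b + b * a = X →
      δ (a * b + b * a) = (2 : ℂ) • (a • δ b) + (2 : ℂ) • (b • δ a))
    (hY : ∀ a b : A, a * b + b * a = Y →
      δ (a * b + b * a) = (2 : ℂ) • (a • δ b) + (2 : ℂ) • (b • δ a)) :
    δ 1 = 0 := by
  have key : ∀ Z : A, (∀ a b : A, a * b + b * a = Z →
      δ (a * b + b * a) = (2 : ℂ) • (a • δ b) + (2 : ℂ) • (b • δ a)) → Z • δ 1 = 0 := by
    intro Z hZ
    have e : 1 * ((2⁻¹ : ℂ) • Z) + ((2⁻¹ : ℂ) • Z) * 1 = Z := by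
      rw [one_mul, mul_one, ← add_smul]
      norm_num
    have h := hZ _ _ e
    rw [e, map_smul, one_smul, smul_assoc, smul_smul, smul_smul] at h
    norm_num at h
    exact h
  rw [← one_smul A (δ 1), ← hXY, add_smul, hXY, key X hX, key Y hY, add_zero]

/-- Applying the map to `t⁻¹ X - (t + 1)⁻¹ X = (t ^ 2 + t)⁻¹ X` determines it on squares, up to
multiplication by `X`. -/
theorem smul_map_mul_self_of_jordanLeftDerivableAt (δ : A →ₗ[ℂ] M) {X : A}
    (hXc : ∀ b : A, X * b = b * X)
    (hX : ∀ a b : A, a * b + b * a = X →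
      δ (a * b + b * a) = (2 : ℂ) • (a • δ b) + (2 : ℂ) • (b • δ a))
    (h1 : δ 1 = 0) {t : A} (ht : IsUnit t) (ht1 : IsUnit (t + 1)) :
    X • δ (t * t) = X • (2 : ℂ) • (t • δ t) := by
  obtain ⟨s, hts, hst⟩ := isUnit_iff_exists.1 ht
  obtain ⟨r, hvr, hrv⟩ := isUnit_iff_exists.1 ht1
  have hsr : s - r = s * r := by
    calc s - r = s * ((t + 1) * r) - (s * t) * r := by rw [hvr, hst, mul_one, one_mul]
      _ = s * r := by noncomm_ring
  have hrs : s - r = r * s := by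
    calc s - r = (r * (t + 1)) * s - r * (t * s) := by rw [hrv, hts, mul_one, one_mul]
      _ = r * s := by noncomm_ring
  have htv : (t + 1) * t = t * (t + 1) := by noncomm_ring
  have hw1 : (t * (t + 1)) * (s * r) = 1 := by
    rw [← hsr, hrs, mul_assoc, ← mul_assoc (t + 1), hvr, one_mul, hts]
  have hw2 : (s * r) * (t * (t + 1)) = 1 := by
    rw [← htv, mul_assoc, ← mul_assoc r, hrv, one_mul, hst]
  have es := map_inv_mul_of_jordanLeftDerivableAt δ hXc hX hts hst
  have er := map_inv_mul_of_jordanLeftDerivableAt δ hXc hX hvr hrv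
  have ew := map_inv_mul_of_jordanLeftDerivableAt δ hXc hX hw1 hw2
  rw [map_add, h1, add_zero] at er
  rw [← hsr, sub_mul, map_sub, es, er, sub_smul, hsr] at ew
  have e : (s * r * (s * r) * X) • δ (t * (t + 1)) = (s * s * X - r * r * X) • δ t := by
    rw [sub_smul]
    linear_combination (norm := abel) ew
  have e' := congrArg (fun m => (t * (t + 1) * (t * (t + 1))) • m) e
  simp only [smul_smul] at e'
  have c1 : t * (t + 1) * (t * (t + 1)) * (s * r * (s * r) * X) = X := by
    calc _ = t * (t + 1) * ((t * (t + 1)) * (s * r)) * (s * r) * X := by simp only [mul_assoc]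
      _ = X := by rw [hw1, mul_one, hw1, one_mul]
  have c2 : t * (t + 1) * (t * (t + 1)) * (s * s * X - r * r * X) = X * (t + t + 1) := by
    have d1 : t * (t + 1) * (t * (t + 1)) * (s * s) = (t + 1) * (t + 1) := by
      calc _ = (t + 1) * (t + 1) * (t * (t * s) * s) := by noncomm_ring
        _ = _ := by rw [hts, mul_one, hts, mul_one]
    have d2 : t * (t + 1) * (t * (t + 1)) * (r * r) = t * t := by
      calc _ = t * t * ((t + 1) * ((t + 1) * r) * r) := by noncomm_ring
        _ = _ := by rw [hvr, mul_one, hvr, mul_one]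
    rw [mul_sub, ← mul_assoc _ (s * s), ← mul_assoc _ (r * r), d1, d2, ← sub_mul, hXc]
    noncomm_ring
  rw [c1, c2, mul_add, mul_one, map_add, mul_smul, add_smul, add_smul, one_smul,
    ← two_smul ℂ (t • δ t), smul_add, smul_add] at e'
  exact add_right_cancel e'

end JordanLeftDerivable

/-- For central `X, Y` with `X + Y = 1`, `δ` is a Jordan left derivation iff `δ` is
Jordan left derivable at `X` and at `Y`. -/
theorem stmt_5
    {A : Type*} [NormedRing A] [NormedAlgebra ℂ A] [CompleteSpace A]
    {M : Type*} [AddCommGroup M] [Module ℂ M] [Module A M] [IsScalarTower ℂ A M]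
    (δ : A →ₗ[ℂ] M) (X Y : A) (hXc : ∀ b : A, X * b = b * X) (hYc : ∀ b : A, Y * b = b * Y)
    (hXY : X + Y = 1) :
    (∀ a b : A, δ (a * b + b * a) = (2 : ℂ) • (a • δ b) + (2 : ℂ) • (b • δ a)) ↔
      ((∀ a b : A, a * b + b * a = X →
          δ (a * b + b * a) = (2 : ℂ) • (a • δ b) + (2 : ℂ) • (b • δ a)) ∧
        (∀ a b : A, a * b + b * a = Y →
          δ (a * b + b * a) = (2 : ℂ) • (a • δ b) + (2 : ℂ) • (b • δ a))) := by
  refine ⟨fun h => ⟨fun a b _ => h a b, fun a b _ => h a b⟩, fun ⟨hX, hY⟩ => ?_⟩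
  have h1 := map_one_of_jordanLeftDerivableAt δ hXY hX hY
  have hunit : ∀ t : A, IsUnit t → IsUnit (t + 1) → δ (t * t) = (2 : ℂ) • (t • δ t) := by
    intro t ht ht1
    have e := congrArg₂ (· + ·) (smul_map_mul_self_of_jordanLeftDerivableAt δ hXc hX h1 ht ht1)
      (smul_map_mul_self_of_jordanLeftDerivableAt δ hYc hY h1 ht ht1)
    simpa only [← add_smul, hXY, one_smul] using e
  have hsq : ∀ a : A, δ (a * a) = (2 : ℂ) • (a • δ a) := by
    intro a
    have hres : ∀ x : ℝ, ‖a‖ * ‖(1 : A)‖ < x → IsUnit (algebraMap ℂ A x - a) := fun x hx =>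
      spectrum.mem_resolventSet_of_norm_lt_mul (by
        simpa using hx.trans_le (le_abs_self x))
    obtain ⟨x, hx⟩ := exists_gt (‖a‖ * ‖(1 : A)‖)
    have hx1 := hres (x + 1) (by linarith)
    have e := hunit _ (hres x hx) (by
      convert hx1 using 1
      rw [Complex.ofReal_add, Complex.ofReal_one, map_add, map_one]
      abel)
    have hmul : (algebraMap ℂ A x - a) * (algebraMap ℂ A x - a)
        = ((x : ℂ) * x) • (1 : A) - (2 * (x : ℂ)) • a + a * a := by
      rw [Algebra.algebraMap_eq_smul_one, sub_mul, mul_sub, mul_sub, smul_mul_assoc, one_mul,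
        smul_mul_assoc, one_mul, mul_smul_comm, mul_one]
      module
    rw [hmul, Algebra.algebraMap_eq_smul_one] at e
    simp only [map_add, map_sub, map_smul, h1, smul_zero, zero_sub, sub_smul, smul_neg,
      smul_assoc, one_smul] at e
    generalize a • δ a = m at e ⊢
    linear_combination (norm := module) e
  intro a b
  have e := hsq (a + b)
  have ea := hsq a
  have eb := hsq b
  simp only [mul_add, add_mul, map_add, smul_add, add_smul] at e ⊢
  rw [ea, eb] at e
  generalize a • δ a = m, b • δ b = n, a • δ b = p, b • δ a = q at e ⊢
  linear_combination (norm := module) e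
end

section
/- Let δ : 𝒜 → ℳ be a (not necessarily continuous) linear map, and let W be an element of the centre Z(𝒜) of 𝒜 which is a left separating point of ℳ. Then the following are equivalent: (i) δ is a Jordan left derivation; (ii) δ is left derivable at W; (iii) δ is Jordan left derivable at W. -/
section JordanLeftDerivation

variable {A : Type*} [Ring A] [Algebra ℂ A]
  {M : Type*} [AddCommGroup M] [Module ℂ M] [Module A M]

/-- A Jordan left derivation `δ` satisfies
`δ (b * a * b) = b ^ 2 • δ a + (3 * b * a) • δ b - (a * b) • δ b`. -/
theorem jordanLeftDerivation_map_mul_mul (δ : A →ₗ[ℂ] M)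
    (h : ∀ a b : A, δ (a * b + b * a) = (2 : ℂ) • (a • δ b) + (2 : ℂ) • (b • δ a))
    (a b : A) :
    δ (b * a * b) = (b * b) • δ a + (3 : ℕ) • ((b * a) • δ b) - (a * b) • δ b := by
  have h1 := h b (b * a + a * b)
  have h2 := h (b * b) a
  have h3 := h b a
  have h4 := h b b
  have e : b * (b * a + a * b) + (b * a + a * b) * b
      = (b * b * a + a * (b * b)) + (2 : ℂ) • (b * a * b) := by
    rw [two_smul]; noncomm_ring
  have h4' : δ (b * b) = (2 : ℂ) • (b • δ b) := by
    rw [← two_smul ℂ (b * b), map_smul, ← two_smul ℂ] at h4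
    exact smul_right_injective M (two_ne_zero' ℂ) h4
  rw [e, map_add, map_smul, h2, h3, h4'] at h1
  refine smul_right_injective M (two_ne_zero' ℂ) ?_
  simp only [two_smul, smul_add, add_smul, mul_smul] at h1 ⊢
  rw [← sub_eq_zero] at h1 ⊢
  rw [← h1]
  abel

/-- A Jordan left derivation is left derivable at every central left separating point. -/
theorem jordanLeftDerivation_map_mul_of_mul_eq (δ : A →ₗ[ℂ] M) (W : A)
    (hWc : ∀ b : A, W * b = b * W) (hsep : ∀ m : M, W • m = 0 → m = 0)
    (h : ∀ a b : A, δ (a * b + b * a) = (2 : ℂ) • (a • δ b) + (2 : ℂ) • (b • δ a))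
    (a b : A) (hab : a * b = W) : δ (a * b) = a • δ b + b • δ a := by
  have h1 := jordanLeftDerivation_map_mul_mul δ h a b
  have h2 : δ (W * b) = W • δ b + b • δ W := by
    have := h W b
    rw [← hWc b, ← two_smul ℂ (W * b), map_smul, ← smul_add] at this
    exact smul_right_injective M (two_ne_zero' ℂ) this
  rw [mul_assoc, hab, ← hWc b, h2] at h1
  have h3 := congrArg (fun m => a • m) h1
  simp only [smul_add, smul_sub, smul_smul, ← mul_assoc, hab, ← hWc a, smul_comm a (3 : ℕ)] at h3
  rw [← sub_eq_zero, hab]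
  apply hsep
  simp only [smul_sub, smul_add, smul_smul]
  rw [← sub_eq_zero] at h3
  rw [← h3]
  abel

/-- If `x` and `1 - x` are units and `δ` satisfies the product rule on all factorizations
`W = u * (u⁻¹ * W)`, then Hua's identity gives `δ (x * x) = x • δ x + x • δ x`. -/
theorem map_mul_self_of_units (δ : A →ₗ[ℂ] M) (W : A)
    (hWc : ∀ b : A, W * b = b * W) (hsep : ∀ m : M, W • m = 0 → m = 0)
    (h : ∀ u : Aˣ, δ W = (u : A) • δ (↑u⁻¹ * W) + (↑u⁻¹ * W) • δ u)
    (u v : Aˣ) (huv : (v : A) = 1 - u) :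
    δ ((u : A) * u) = (u : A) • δ u + (u : A) • δ u := by
  have h1 : δ 1 = 0 := by
    have := h 1
    simp only [Units.val_one, inv_one, one_mul, one_smul] at this
    exact hsep _ (by simpa using this)
  have huv' : (u : A) * v = v * u := by rw [huv]; noncomm_ring
  have hD : ∀ t : Aˣ, (t : A) • (t : A) • δ (↑t⁻¹ * W) = (t : A) • δ W - W • δ t := by
    intro t
    have := congrArg (fun m => (t : A) • m) (h t)
    simp only [smul_add, smul_smul, ← mul_assoc, Units.mul_inv, one_mul] at this
    rw [this, smul_smul]
    abel
  have hu := hD u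
  have hv := hD v
  have hp := hD (u * v)
  have hinv : ((u * v)⁻¹ : Aˣ) * W = (↑u⁻¹ * W) + (↑v⁻¹ * W) := by
    rw [← add_mul]
    congr 1
    apply (u * v).isUnit.mul_left_cancel
    rw [Units.mul_inv, Units.val_mul, mul_add, Units.mul_inv_cancel_right, huv',
      Units.mul_inv_cancel_right, huv]
    abel
  rw [hinv, map_add, Units.val_mul] at hp
  have e1 : ((u : A) * v) • ((u : A) * v) • δ (↑u⁻¹ * W)
      = ((v : A) * v) • ((u : A) • δ W - W • δ u) := by
    rw [← hu]
    simp only [smul_smul]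
    congr 1
    rw [huv]; noncomm_ring
  have e2 : ((u : A) * v) • ((u : A) * v) • δ (↑v⁻¹ * W)
      = ((u : A) * u) • ((v : A) • δ W - W • δ v) := by
    rw [← hv]
    simp only [smul_smul]
    congr 1
    rw [huv]; noncomm_ring
  rw [smul_add, smul_add, e1, e2] at hp
  have hvd : δ v = -δ u := by rw [huv, map_sub, h1, zero_sub]
  have hm : (u : A) * v = u - u * u := by rw [huv]; noncomm_ring
  rw [hvd, hm, map_sub] at hp
  rw [← sub_eq_zero]
  apply hsep
  have hW : ∀ (b : A) (m : M), W • b • m = b • W • m := fun b m => by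
    rw [smul_smul, hWc, mul_smul]
  rw [huv] at hp
  simp only [smul_sub, smul_add, smul_neg, sub_smul, one_smul, mul_sub, sub_mul, mul_one,
    one_mul, mul_smul, hW] at hp ⊢
  rw [eq_comm, ← sub_eq_zero] at hp
  rw [← hp]
  abel

end JordanLeftDerivation

/-- In a complex Banach algebra, every element is of the form `c - u` with `c` a scalar and
both `u` and `1 - u` invertible. -/
theorem exists_units_algebraMap_sub {A : Type*} [NormedRing A] [NormedAlgebra ℂ A]
    [CompleteSpace A] (a : A) :
    ∃ (c : ℂ) (u v : Aˣ), (u : A) = algebraMap ℂ A c - a ∧ (v : A) = 1 - u := by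
  set r : ℝ := ‖a‖ * ‖(1 : A)‖ with hr
  have hr0 : 0 ≤ r := by positivity
  have key : ∀ s : ℝ, r < s → IsUnit (algebraMap ℂ A (s : ℂ) - a) := by
    intro s hs
    refine spectrum.mem_resolventSet_of_norm_lt_mul ?_
    rwa [Complex.norm_real, Real.norm_of_nonneg (hr0.trans hs.le)]
  obtain ⟨u, hu⟩ := key (r + 2) (by linarith)
  obtain ⟨v, hv⟩ := key (r + 1) (by linarith)
  refine ⟨_, u, -v, hu, ?_⟩
  rw [Units.val_neg, hu, hv]
  have : ((r + 2 : ℝ) : ℂ) = ((r + 1 : ℝ) : ℂ) + 1 := by push_cast; ring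
  rw [this, map_add, map_one]
  abel

/-- A linear map satisfying the product rule on all factorizations `W = u * (u⁻¹ * W)` of a central
left separating point `W` is a Jordan left derivation. -/
theorem jordanLeftDerivation_of_units {A : Type*} [NormedRing A] [NormedAlgebra ℂ A]
    [CompleteSpace A] {M : Type*} [AddCommGroup M] [Module ℂ M] [Module A M] [IsScalarTower ℂ A M]
    (δ : A →ₗ[ℂ] M) (W : A) (hWc : ∀ b : A, W * b = b * W)
    (hsep : ∀ m : M, W • m = 0 → m = 0)
    (h : ∀ u : Aˣ, δ W = (u : A) • δ (↑u⁻¹ * W) + (↑u⁻¹ * W) • δ u) (a b : A) :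
    δ (a * b + b * a) = (2 : ℂ) • (a • δ b) + (2 : ℂ) • (b • δ a) := by
  have h1 : δ 1 = 0 := by
    have := h 1
    simp only [Units.val_one, inv_one, one_mul, one_smul] at this
    exact hsep _ (by simpa using this)
  have hsq : ∀ x : A, δ (x * x) = x • δ x + x • δ x := by
    intro x
    obtain ⟨c, u, v, hu, hv⟩ := exists_units_algebraMap_sub x
    have hc := map_mul_self_of_units δ W hWc hsep h u v hv
    have e : (algebraMap ℂ A c - x) * (algebraMap ℂ A c - x)
        = (c * c) • (1 : A) - c • x - c • x + x * x := by
      rw [Algebra.algebraMap_eq_smul_one]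
      simp only [sub_mul, mul_sub, smul_mul_assoc, mul_smul_comm, one_mul, mul_one, smul_sub,
        mul_smul]
      abel
    rw [hu, e] at hc
    simp only [map_add, map_sub, map_smul, h1, smul_zero, Algebra.algebraMap_eq_smul_one,
      sub_smul, smul_assoc, one_smul, smul_neg, zero_sub] at hc
    rw [← sub_eq_zero] at hc ⊢
    rw [← hc]
    abel
  have hab := hsq (a + b)
  rw [show (a + b) * (a + b) = a * a + (a * b + b * a) + b * b by noncomm_ring, map_add, map_add,
    hsq a, hsq b] at hab
  simp only [map_add, smul_add, add_smul, two_smul] at hab ⊢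
  rw [← sub_eq_zero] at hab ⊢
  rw [← hab]
  abel

/-- For a central left separating point `W`: `δ` is a Jordan left derivation iff
`δ` is left derivable at `W` iff `δ` is Jordan left derivable at `W`. -/
theorem stmt_6
    {A : Type*} [NormedRing A] [NormedAlgebra ℂ A] [CompleteSpace A]
    {M : Type*} [AddCommGroup M] [Module ℂ M] [Module A M] [IsScalarTower ℂ A M]
    (δ : A →ₗ[ℂ] M) (W : A) (hWc : ∀ b : A, W * b = b * W)
    (hsep : ∀ m : M, W • m = 0 → m = 0) :
    ((∀ a b : A, δ (a * b + b * a) = (2 : ℂ) • (a • δ b) + (2 : ℂ) • (b • δ a)) ↔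
        (∀ a b : A, a * b = W → δ (a * b) = a • δ b + b • δ a)) ∧
      ((∀ a b : A, δ (a * b + b * a) = (2 : ℂ) • (a • δ b) + (2 : ℂ) • (b • δ a)) ↔
        (∀ a b : A, a * b + b * a = W →
          δ (a * b + b * a) = (2 : ℂ) • (a • δ b) + (2 : ℂ) • (b • δ a))) := by
  refine ⟨⟨jordanLeftDerivation_map_mul_of_mul_eq δ W hWc hsep, fun h => ?_⟩,
    ⟨fun h a b _ => h a b, fun h => ?_⟩⟩
  · refine jordanLeftDerivation_of_units δ W hWc hsep fun u => ?_
    have hu : (u : A) * (↑u⁻¹ * W) = W := Units.mul_inv_cancel_left u W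
    simpa only [hu] using h u (↑u⁻¹ * W) hu
  · refine jordanLeftDerivation_of_units δ W hWc hsep fun u => ?_
    have hu : (u : A) * (↑u⁻¹ * W) = W := Units.mul_inv_cancel_left u W
    have hu' : (↑u⁻¹ * W) * (u : A) = W := by
      rw [mul_assoc, hWc, Units.inv_mul_cancel_left]
    have e : (u : A) * (↑u⁻¹ * W) + (↑u⁻¹ * W) * (u : A) = (2 : ℂ) • W := by
      rw [hu, hu', two_smul]
    have e' : ((2 : ℂ)⁻¹ • (u : A)) * (↑u⁻¹ * W) + (↑u⁻¹ * W) * ((2 : ℂ)⁻¹ • (u : A)) = W := by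
      rw [smul_mul_assoc, mul_smul_comm, ← smul_add, e, inv_smul_smul₀ (two_ne_zero' ℂ)]
    have := h _ _ e'
    have hcomm : (↑u⁻¹ * W) • (2 : ℂ)⁻¹ • δ (u : A) = (2 : ℂ)⁻¹ • (↑u⁻¹ * W) • δ (u : A) := by
      rw [← smul_one_smul A (2 : ℂ)⁻¹ (δ (u : A)), smul_smul, mul_smul_comm, mul_one, smul_assoc]
    rwa [e', map_smul, smul_assoc, hcomm, smul_inv_smul₀ (two_ne_zero' ℂ),
      smul_inv_smul₀ (two_ne_zero' ℂ)] at this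
end

section
/- Let 𝒜 be a unital semisimple complex Banach algebra and let δ : 𝒜 → 𝒜 be a continuous linear map. If δ is left derivable at I, or if δ is Jordan left derivable at I, then δ = 0. -/
/-- An additive map with `D (x²) = 2 x D x` satisfies the linearized identity. -/
theorem AddMonoidHom.map_mul_add_mul_of_map_sq {R : Type*} [Ring R] {D : R →+ R}
    (hD : ∀ x, D (x * x) = 2 * (x * D x)) (a b : R) :
    D (a * b) + D (b * a) = 2 * (a * D b) + 2 * (b * D a) := by
  have h := hD (a + b)
  simp only [mul_add, add_mul, map_add] at h
  linear_combination (norm := noncomm_ring) h - hD a - hD b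

section JordanLeft

variable {R : Type*} [Ring R] {D : R →+ R}

theorem AddMonoidHom.map_mul_mul_self_of_map_sq (h2 : ∀ x : R, x + x = 0 → x = 0)
    (hD : ∀ x, D (x * x) = 2 * (x * D x)) (a b : R) :
    D (a * b * a) = a * a * D b + 3 * (a * b * D a) - b * a * D a := by
  have J := AddMonoidHom.map_mul_add_mul_of_map_sq hD
  have h1 := J a (a * b + b * a)
  have h3 := J (a * a) b
  have h4 := J a b
  simp only [mul_add, add_mul, map_add, ← mul_assoc] at h1 h3 h4
  rw [hD a] at h3
  rw [← sub_eq_zero]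
  apply h2
  linear_combination (norm := noncomm_ring) h1 - h3 + 2 * a * h4

theorem AddMonoidHom.map_mul_mul_add_of_map_sq (h2 : ∀ x : R, x + x = 0 → x = 0)
    (hD : ∀ x, D (x * x) = 2 * (x * D x)) (a b c : R) :
    D (a * b * c) + D (c * b * a) = (a * c + c * a) * D b + 3 * (a * b * D c)
      + 3 * (c * b * D a) - b * a * D c - b * c * D a := by
  have H := AddMonoidHom.map_mul_mul_self_of_map_sq h2 hD
  have h1 := H (a + c) b
  simp only [mul_add, add_mul, map_add, ← mul_assoc] at h1
  linear_combination (norm := noncomm_ring) h1 - H a b - H c b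

theorem commutator_mul_map_mul_of_map_sq (h2 : ∀ x : R, x + x = 0 → x = 0)
    (hD : ∀ x, D (x * x) = 2 * (x * D x)) (a b : R) :
    (a * b - b * a) * D (a * b) = a * (a * b - b * a) * D b + b * (a * b - b * a) * D a := by
  have h1 := AddMonoidHom.map_mul_mul_add_of_map_sq h2 hD a b (a * b)
  have h3 := hD (a * b)
  have h4 := AddMonoidHom.map_mul_mul_self_of_map_sq h2 hD a (b * b)
  simp only [hD b, ← mul_assoc] at h1 h3 h4
  linear_combination (norm := noncomm_ring) - h1 + h3 + h4

theorem lie_lie_mul_map_of_map_sq (h2 : ∀ x : R, x + x = 0 → x = 0)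
    (hD : ∀ x, D (x * x) = 2 * (x * D x)) (a x : R) : ⁅a, ⁅a, x⁆⁆ * D a = 0 := by
  have h1 := commutator_mul_map_mul_of_map_sq h2 hD a (a + x)
  have h3 := commutator_mul_map_mul_of_map_sq h2 hD a x
  simp only [mul_add, map_add, hD a] at h1
  apply h2
  simp only [Ring.lie_def]
  linear_combination (norm := noncomm_ring) h3 - h1

theorem lie_lie_lie_mul_mul_map_self_of_map_sq (h2 : ∀ x : R, x + x = 0 → x = 0)
    (hD : ∀ x, D (x * x) = 2 * (x * D x)) (a x y : R) :
    ⁅a, ⁅a, ⁅a, x⁆⁆⁆ * y * D a = 0 := by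
  have H := lie_lie_mul_map_of_map_sq h2 hD a
  have key : ∀ x y, ⁅a, ⁅a, x⁆⁆ * y * D a + 2 * (⁅a, x⁆ * ⁅a, y⁆ * D a) = 0 := by
    intro x y
    have h1 := H (x * y)
    have h3 := H y
    simp only [Ring.lie_def] at *
    linear_combination (norm := noncomm_ring) h1 - x * h3
  have h3 := key x ⁅a, y⁆
  have h4 := key ⁅a, x⁆ y
  rw [mul_assoc ⁅a, x⁆, H y] at h3
  linear_combination (norm := noncomm_ring) h4 - 2 * h3

theorem lie_lie_lie_mul_mul_map_of_map_sq (h2 : ∀ x : R, x + x = 0 → x = 0)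
    (h3 : ∀ x : R, x + x + x = 0 → x = 0)
    (hR : ∀ u : R, (∀ y, u * y * u = 0) → u = 0)
    (hD : ∀ x, D (x * x) = 2 * (x * D x)) (a b x y : R) :
    ⁅a, ⁅a, ⁅a, x⁆⁆⁆ * y * D b = 0 := by
  have H := lie_lie_lie_mul_mul_map_self_of_map_sq h2 hD
  have add_lie' : ∀ u v w : R, ⁅u + v, w⁆ = ⁅u, w⁆ + ⁅v, w⁆ := by
    intros; simp only [Ring.lie_def]; noncomm_ring
  have sub_lie' : ∀ u v w : R, ⁅u - v, w⁆ = ⁅u, w⁆ - ⁅v, w⁆ := by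
    intros; simp only [Ring.lie_def]; noncomm_ring
  have lie_add' : ∀ u v w : R, ⁅u, v + w⁆ = ⁅u, v⁆ + ⁅u, w⁆ := by
    intros; simp only [Ring.lie_def]; noncomm_ring
  have lie_sub' : ∀ u v w : R, ⁅u, v - w⁆ = ⁅u, v⁆ - ⁅u, w⁆ := by
    intros; simp only [Ring.lie_def]; noncomm_ring
  have lin : ⁅a, ⁅a, ⁅a, x⁆⁆⁆ * y * D b
      + (⁅b, ⁅a, ⁅a, x⁆⁆⁆ + ⁅a, ⁅b, ⁅a, x⁆⁆⁆ + ⁅a, ⁅a, ⁅b, x⁆⁆⁆) * y * D a = 0 := by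
    apply h2
    apply h3
    have e0 := H a x y
    have e1 := H (a + b) x y
    have e2 := H (a - b) x y
    have e3 := H (a + (b + b)) x y
    have e4 := H b x y
    simp only [map_add, map_sub, add_lie', lie_add', sub_lie', lie_sub'] at e1 e2 e3
    linear_combination (norm := noncomm_ring)
      6 * e1 - 2 * e2 - e3 - 3 * e0 + 12 * e4
  have flip : ∀ z, D a * z * ⁅a, ⁅a, ⁅a, x⁆⁆⁆ = 0 := by
    intro z
    apply hR
    intro s
    linear_combination (norm := noncomm_ring) D a * z * H a x s * z * ⁅a, ⁅a, ⁅a, x⁆⁆⁆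
  apply hR
  intro z
  linear_combination (norm := noncomm_ring) lin * z * ⁅a, ⁅a, ⁅a, x⁆⁆⁆ * y * D b
    - (⁅b, ⁅a, ⁅a, x⁆⁆⁆ + ⁅a, ⁅b, ⁅a, x⁆⁆⁆ + ⁅a, ⁅a, ⁅b, x⁆⁆⁆) * y * flip z * y * D b

end JordanLeft

/-- A semiprime ring without `2`- and `3`-torsion satisfying the third Engel identity is
commutative. -/
theorem mul_comm_of_lie_lie_lie_eq_zero {R : Type*} [Ring R] (h2 : ∀ x : R, x + x = 0 → x = 0)
    (h3 : ∀ x : R, x + x + x = 0 → x = 0)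
    (hR : ∀ u : R, (∀ y, u * y * u = 0) → u = 0)
    (H : ∀ a x : R, ⁅a, ⁅a, ⁅a, x⁆⁆⁆ = 0) (a b : R) : a * b = b * a := by
  simp only [Ring.lie_def] at H
  have lin : ∀ a b x : R, ⁅b, ⁅a, ⁅a, x⁆⁆⁆ + ⁅a, ⁅b, ⁅a, x⁆⁆⁆ + ⁅a, ⁅a, ⁅b, x⁆⁆⁆ = 0 := by
    intro a b x
    apply h2
    simp only [Ring.lie_def]
    linear_combination (norm := noncomm_ring) H (a + b) x - H (a - b) x - 2 * H b x
  simp only [Ring.lie_def] at lin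
  have sq_mul : ∀ a x y : R, ⁅a, ⁅a, x⁆⁆ * ⁅a, y⁆ = 0 := by
    intro a x y
    apply h3
    apply h2
    simp only [Ring.lie_def]
    linear_combination (norm := noncomm_ring) 3 * lin a (a * y) x - 3 * a * lin a y x
      - 8 * H a x * y - H a (x * y) + x * H a y
  have sq_eq : ∀ a x : R, ⁅a, ⁅a, x⁆⁆ = 0 := by
    intro a x
    apply hR
    intro y
    have h := sq_mul a x (y * ⁅a, x⁆)
    have h' := sq_mul a x y
    simp only [Ring.lie_def] at h h' ⊢
    linear_combination (norm := noncomm_ring) h - h' * (a * x - x * a)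
  have mul_eq : ∀ x y : R, ⁅a, x⁆ * ⁅a, y⁆ = 0 := by
    intro x y
    apply h2
    have h := sq_eq a (x * y)
    have h' := sq_eq a x
    have h'' := sq_eq a y
    simp only [Ring.lie_def] at h h' h'' ⊢
    linear_combination (norm := noncomm_ring) h - h' * y - x * h''
  rw [← sub_eq_zero]
  apply hR
  intro y
  have h := mul_eq b (y * b)
  have h' := mul_eq b y
  simp only [Ring.lie_def] at h h'
  linear_combination (norm := noncomm_ring) h - h' * b

section Semiprime

variable {R : Type*} [Ring R] {D : R →+ R}

/-- The left annihilator of the two-sided ideal generated by the range of `D`. -/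
def AddMonoidHom.rangeAnnihilator (D : R →+ R) : Ideal R where
  carrier := {k | ∀ y b, k * y * D b = 0}
  add_mem' hk hl y b := by simp [add_mul, hk y b, hl y b]
  zero_mem' y b := by simp
  smul_mem' c k hk y b := by rw [smul_eq_mul, mul_assoc c, mul_assoc c, hk y b, mul_zero]

instance (D : R →+ R) : D.rangeAnnihilator.IsTwoSided where
  mul_mem_of_left {k} c hk y b := by rw [mul_assoc k]; exact hk (c * y) b

theorem lie_mul_mul_map_of_map_sq (h2 : ∀ x : R, x + x = 0 → x = 0)
    (h3 : ∀ x : R, x + x + x = 0 → x = 0)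
    (hR : ∀ u : R, (∀ y, u * y * u = 0) → u = 0)
    (hD : ∀ x, D (x * x) = 2 * (x * D x)) (a b y z : R) :
    (a * b - b * a) * y * D z = 0 := by
  have hmk : ∀ k : R, Ideal.Quotient.mk D.rangeAnnihilator k = 0 ↔ ∀ y b, k * y * D b = 0 :=
    fun k ↦ Ideal.Quotient.eq_zero_iff_mem
  revert y z
  rw [← hmk, map_sub, map_mul, map_mul, sub_eq_zero]
  apply mul_comm_of_lie_lie_lie_eq_zero
  · intro x
    obtain ⟨x, rfl⟩ := Ideal.Quotient.mk_surjective x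
    rw [← map_add, hmk, hmk]
    intro h y b
    apply h2
    rw [← h y b, add_mul, add_mul]
  · intro x
    obtain ⟨x, rfl⟩ := Ideal.Quotient.mk_surjective x
    rw [← map_add, ← map_add, hmk, hmk]
    intro h y b
    apply h3
    rw [← h y b, add_mul, add_mul, add_mul, add_mul]
  · intro u h
    obtain ⟨u, rfl⟩ := Ideal.Quotient.mk_surjective u
    rw [hmk]
    intro y b
    apply hR
    intro s
    have := h (Ideal.Quotient.mk _ (y * D b * s))
    rw [← map_mul, ← map_mul, hmk] at this
    rw [← this y b]
    noncomm_ring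
  · intro a x
    obtain ⟨a, rfl⟩ := Ideal.Quotient.mk_surjective a
    obtain ⟨x, rfl⟩ := Ideal.Quotient.mk_surjective x
    have h := (hmk _).2 fun y b ↦ lie_lie_lie_mul_mul_map_of_map_sq h2 h3 hR hD a b x y
    simpa only [Ring.lie_def, map_sub, map_mul] using h

theorem commute_map_of_map_sq (h2 : ∀ x : R, x + x = 0 → x = 0)
    (h3 : ∀ x : R, x + x + x = 0 → x = 0)
    (hR : ∀ u : R, (∀ y, u * y * u = 0) → u = 0)
    (hD : ∀ x, D (x * x) = 2 * (x * D x)) (a y : R) : Commute (D a) y := by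
  have H := lie_mul_mul_map_of_map_sq h2 h3 hR hD (D a) y
  rw [commute_iff_eq, ← sub_eq_zero]
  apply hR
  intro z
  linear_combination (norm := noncomm_ring) H z a * y - H (z * y) a

theorem map_mul_of_map_sq (h2 : ∀ x : R, x + x = 0 → x = 0)
    (h3 : ∀ x : R, x + x + x = 0 → x = 0)
    (hR : ∀ u : R, (∀ y, u * y * u = 0) → u = 0)
    (hD : ∀ x, D (x * x) = 2 * (x * D x)) (a b : R) : D (a * b) = a * D b + b * D a := by
  have hc := commute_map_of_map_sq h2 h3 hR hD
  have J := AddMonoidHom.map_mul_add_mul_of_map_sq hD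
  have hu : ∀ z, (a * b - b * a) * D z = 0 := fun z ↦ by
    simpa using lie_mul_mul_map_of_map_sq h2 h3 hR hD a b 1 z
  have comm : D (a * b - b * a) = 0 := by
    set u := a * b - b * a
    have hsq : D u * D u = 0 := by
      apply h2
      have h := J u (D u)
      rw [(hc u u).eq, hu, hu, map_zero] at h
      linear_combination (norm := noncomm_ring) -h
    apply hR
    intro y
    rw [(hc u y).eq, mul_assoc, hsq, mul_zero]
  rw [map_sub] at comm
  rw [← sub_eq_zero]
  apply h2
  linear_combination (norm := noncomm_ring) comm + J a b

end Semiprime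

/-- **Singer–Wermer theorem**: a continuous derivation of a commutative complex Banach algebra
maps into the kernel of every character. -/
theorem WeakDual.CharacterSpace.apply_derivation_eq_zero {B : Type*} [NormedCommRing B]
    [NormedAlgebra ℂ B] [CompleteSpace B] (D : Derivation ℂ B B) {C : ℝ}
    (hC : ∀ x, ‖D x‖ ≤ C * ‖x‖) (φ : WeakDual.characterSpace ℂ B) (x : B) : φ (D x) = 0 := by
  have key : ∀ x : B, φ x = 0 → ∀ k n : ℕ, k ≤ n → ∀ y,
      φ (D^[k] (x ^ n * y)) = if k = n then n.factorial * φ (D x) ^ n * φ y else 0 := by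
    intro x hx k
    induction k with
    | zero =>
      rintro (_ | n) - y
      · simp
      · simp [hx]
    | succ k ih =>
      rintro (_ | n) hkn y
      · simp at hkn
      · have e : D (x ^ (n + 1) * y) = x ^ n * ((n + 1) * (D x * y) + x * D y) := by
          simp only [Derivation.leibniz, Derivation.leibniz_pow, smul_eq_mul, nsmul_eq_mul,
            Nat.add_sub_cancel]
          push_cast
          ring
        rw [Function.iterate_succ_apply, e, ih n (by omega)]
        by_cases h : k = n
        · simp [h, hx, Nat.factorial_succ]
          ring
        · simp [h]
  have bound : ∀ n (x : B), ‖D^[n] x‖ ≤ |C| ^ n * ‖x‖ := by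
    intro n
    induction n with
    | zero => simp
    | succ n ih =>
      intro x
      rw [Function.iterate_succ_apply, pow_succ, mul_assoc]
      refine (ih _).trans ?_
      gcongr
      exact (hC x).trans (by gcongr; exact le_abs_self C)
  have main : ∀ x : B, φ x = 0 → φ (D x) = 0 := by
    intro x hx
    by_contra hne
    set L := ‖WeakDual.CharacterSpace.toCLM φ‖
    have hL : ∀ y, ‖φ y‖ ≤ L * ‖y‖ := (WeakDual.CharacterSpace.toCLM φ).le_opNorm
    have hpos : 0 < ‖φ (D x)‖ := norm_pos_iff.2 hne
    set r := |C| * ‖x‖ / ‖φ (D x)‖ with hr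
    have hle : ∀ n : ℕ, 1 ≤ n → 1 ≤ L * (r ^ n / n.factorial) := by
      intro n hn
      have h1 := key x hx n n le_rfl 1
      have h2 : ‖φ (D^[n] (x ^ n * 1))‖ ≤ L * (|C| ^ n * ‖x‖ ^ n) := by
        refine (hL _).trans ?_
        gcongr
        refine (bound n _).trans ?_
        rw [mul_one]
        gcongr
        exact norm_pow_le' x hn
      rw [h1] at h2
      simp only [if_true, map_one, mul_one, norm_mul, norm_pow, Complex.norm_natCast] at h2
      have hf : (0 : ℝ) < n.factorial := by exact_mod_cast n.factorial_pos
      rw [hr, div_pow, mul_pow, div_div, ← mul_div_assoc, le_div_iff₀ (by positivity)]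
      linarith
    have ht := ((FloorSemiring.tendsto_pow_div_factorial_atTop r).const_mul L)
    rw [mul_zero] at ht
    obtain ⟨n, h1, h2⟩ := ((ht.eventually_lt_const one_pos).and
      (Filter.eventually_ge_atTop 1)).exists
    exact absurd (hle n h2) (not_le.2 h1)
  have h := main (x - algebraMap ℂ B (φ x)) (by simp [AlgHomClass.commutes])
  simpa using h

/-- A continuous derivation of a commutative complex Banach algebra takes quasinilpotent
values. -/
theorem Derivation.exists_norm_apply_pow_lt {B : Type*} [NormedCommRing B]
    [NormedAlgebra ℂ B] [CompleteSpace B] (D : Derivation ℂ B B) {C : ℝ}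
    (hC : ∀ x, ‖D x‖ ≤ C * ‖x‖) (x : B) {ε : ℝ} (hε : 0 < ε) :
    ∃ n : ℕ, 1 ≤ n ∧ ‖D x ^ n‖ < ε ^ n := by
  have hs : spectralRadius ℂ (D x) = 0 := by
    refine le_antisymm (iSup₂_le fun z hz ↦ ?_) bot_le
    obtain ⟨φ, rfl⟩ := WeakDual.CharacterSpace.mem_spectrum_iff_exists.1 hz
    simp [WeakDual.CharacterSpace.apply_derivation_eq_zero D hC φ x]
  have ht := spectrum.pow_norm_pow_one_div_tendsto_nhds_spectralRadius (D x)
  rw [hs] at ht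
  obtain ⟨n, h1, h2⟩ := ((ht.eventually_lt_const (ENNReal.ofReal_pos.2 hε)).and
      (Filter.eventually_ge_atTop 1)).exists
  refine ⟨n, h2, ?_⟩
  rw [ENNReal.ofReal_lt_ofReal_iff hε] at h1
  have h3 := pow_lt_pow_left₀ h1 (by positivity) (by omega : n ≠ 0)
  rwa [one_div, Real.rpow_inv_natCast_pow (norm_nonneg _) (by omega)] at h3

/-- A ring with zero Jacobson radical is semiprime. -/
theorem eq_zero_of_mul_mul_self_eq_zero {R : Type*} [Ring R]
    (hss : Ideal.jacobson (⊥ : Ideal R) = ⊥) (u : R) (hu : ∀ y, u * y * u = 0) : u = 0 := by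
  rw [← Ideal.mem_bot, ← hss, Ideal.mem_jacobson_iff]
  intro y
  refine ⟨1 - y * u, Ideal.mem_bot.2 ?_⟩
  linear_combination (norm := noncomm_ring) -(y * hu y)

/-- A central quasinilpotent element lies in the Jacobson radical. -/
theorem mem_jacobson_bot_of_commute_of_norm_pow_lt {A : Type*} [NormedRing A]
    [CompleteSpace A] {c : A} (hc : ∀ y, Commute c y)
    (hq : ∀ ε : ℝ, 0 < ε → ∃ n : ℕ, 1 ≤ n ∧ ‖c ^ n‖ < ε ^ n) :
    c ∈ Ideal.jacobson (⊥ : Ideal A) := by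
  rw [Ideal.mem_jacobson_iff]
  intro y
  obtain ⟨n, hn, h⟩ := hq (‖y‖ + 1)⁻¹ (by positivity)
  have hlt : ‖(-(y * c)) ^ n‖ < 1 := by
    rw [← neg_mul, ((hc (-y)).symm).mul_pow]
    calc ‖(-y) ^ n * c ^ n‖ ≤ ‖(-y) ^ n‖ * ‖c ^ n‖ := norm_mul_le _ _
      _ ≤ (‖y‖ + 1) ^ n * ‖c ^ n‖ := by
        gcongr
        refine (norm_pow_le' _ hn).trans ?_
        rw [norm_neg]
        gcongr
        linarith
      _ < (‖y‖ + 1) ^ n * (‖y‖ + 1)⁻¹ ^ n := by gcongr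
      _ = 1 := by rw [← mul_pow, mul_inv_cancel₀ (by positivity), one_pow]
  obtain ⟨v, hv⟩ := (isUnit_one_sub_of_norm_lt_one hlt).exists_left_inv
  refine ⟨v * ∑ i ∈ Finset.range n, (-(y * c)) ^ i, Ideal.mem_bot.2 ?_⟩
  rw [← geom_sum_mul_neg] at hv
  linear_combination (norm := noncomm_ring) hv

section Banach

variable {A : Type*} [NormedRing A] [NormedAlgebra ℂ A] [CompleteSpace A]

/-- A continuous derivation of a semisimple Banach algebra with central values vanishes on the
center. -/
theorem derivation_apply_eq_zero_of_mem_center (hss : Ideal.jacobson (⊥ : Ideal A) = ⊥)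
    (δ : A →L[ℂ] A) (hcomm : ∀ a y, Commute (δ a) y)
    (hmul : ∀ a b, δ (a * b) = a * δ b + b * δ a) {z : A}
    (hz : z ∈ Subalgebra.center ℂ A) : δ z = 0 := by
  have hmem : ∀ a, δ a ∈ Subalgebra.center ℂ A := fun a ↦
    Subalgebra.mem_center_iff.2 fun y ↦ (hcomm a y).symm.eq
  let _ : NormedCommRing (Subalgebra.center ℂ A) :=
    { (inferInstance : NormedRing (Subalgebra.center ℂ A)) with
      mul_comm := mul_comm }
  let _ : NormedAlgebra ℂ (Subalgebra.center ℂ A) := Subalgebra.toNormedAlgebra _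
  have hclosed : IsClosed (Subalgebra.center ℂ A : Set A) := by
    have h : (Subalgebra.center ℂ A : Set A) = Set.centralizer Set.univ := by
      rw [Set.centralizer_univ]; rfl
    rw [h]
    exact Set.isClosed_centralizer _
  have : CompleteSpace (Subalgebra.center ℂ A) := hclosed.completeSpace_coe
  let D : Derivation ℂ (Subalgebra.center ℂ A) (Subalgebra.center ℂ A) := Derivation.mk'
    { toFun := fun x ↦ ⟨δ x, hmem x⟩
      map_add' := fun x y ↦ Subtype.ext (map_add δ (x : A) y)
      map_smul' := fun c x ↦ Subtype.ext (map_smul δ c (x : A)) }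
    fun x y ↦ Subtype.ext (hmul x y)
  rw [← Ideal.mem_bot, ← hss]
  refine mem_jacobson_bot_of_commute_of_norm_pow_lt (hcomm z) fun ε hε ↦ ?_
  exact D.exists_norm_apply_pow_lt (C := ‖δ‖) (fun x ↦ δ.le_opNorm x) ⟨z, hz⟩ hε

/-- A continuous Jordan left derivation of a semisimple Banach algebra is zero. -/
theorem eq_zero_of_map_sq (hss : Ideal.jacobson (⊥ : Ideal A) = ⊥) (δ : A →L[ℂ] A)
    (hδ : ∀ x, δ (x * x) = 2 * (x * δ x)) : δ = 0 := by
  have hR := eq_zero_of_mul_mul_self_eq_zero hss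
  have h2 : ∀ x : A, x + x = 0 → x = 0 := fun x hx ↦ by
    have h : (2 : ℂ) • x = 0 := by rw [two_smul, hx]
    simpa using h
  have h3 : ∀ x : A, x + x + x = 0 → x = 0 := fun x hx ↦ by
    have h : (3 : ℂ) • x = 0 := by rw [← hx]; module
    simpa using h
  let D : A →+ A := δ.toLinearMap.toAddMonoidHom
  have hcomm : ∀ a y, Commute (δ a) y := commute_map_of_map_sq (D := D) h2 h3 hR hδ
  have hmul : ∀ a b, δ (a * b) = a * δ b + b * δ a := map_mul_of_map_sq (D := D) h2 h3 hR hδ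
  ext a
  have h0 : δ (δ a) = 0 := derivation_apply_eq_zero_of_mem_center hss δ hcomm hmul
    (Subalgebra.mem_center_iff.2 fun y ↦ (hcomm a y).symm.eq)
  have hsq : δ a * δ a = 0 := by
    apply h2
    have h : δ (δ (a * a)) = 0 := derivation_apply_eq_zero_of_mem_center hss δ hcomm hmul
      (Subalgebra.mem_center_iff.2 fun y ↦ (hcomm _ y).symm.eq)
    rw [hmul, map_add, hmul a (δ a), h0] at h
    simpa using h
  apply hR
  intro y
  rw [(hcomm a y).eq, mul_assoc, hsq, mul_zero]

/-- If `a δ(b) + b δ(a) = 0` whenever `b` is the inverse of `a`, then `δ` is a Jordan left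
derivation. -/
theorem map_sq_of_map_inverse (δ : A →L[ℂ] A)
    (h : ∀ u : Aˣ, (u : A) * δ ↑u⁻¹ + (↑u⁻¹ : A) * δ u = 0) (x : A) :
    δ (x * x) = 2 * (x * δ x) := by
  have hinv : ∀ u : Aˣ, (u : A) * u * δ ↑u⁻¹ = -δ u := fun u ↦ by
    have h' := congrArg ((u : A) * ·) (h u)
    simp only [mul_add, ← mul_assoc, Units.mul_inv, one_mul, mul_zero] at h'
    exact eq_neg_of_add_eq_zero_left h'
  have hone : δ 1 = 0 := by
    have h1 := h 1
    simp only [inv_one, Units.val_one, one_mul] at h1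
    rw [← two_smul ℂ] at h1
    simpa using h1
  have hunit : ∀ u v : Aˣ, (u : A) + v = 1 → δ ((u : A) * u) = 2 * (u * δ u) := by
    intro u v huv
    obtain hv : (v : A) = 1 - u := eq_sub_of_add_eq' huv
    have hcomm : (u : A) * v = v * u := by rw [hv]; noncomm_ring
    have hsum : (↑(u * v)⁻¹ : A) = ↑u⁻¹ + ↑v⁻¹ := by
      refine Units.inv_eq_of_mul_eq_one_right ?_
      rw [Units.val_mul, mul_add, hcomm, mul_assoc, Units.mul_inv, ← hcomm, mul_assoc,
        Units.mul_inv, mul_one, mul_one, add_comm, huv]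
    have e := hinv (u * v)
    rw [hsum, map_add, mul_add] at e
    have e1 : ((u * v : Aˣ) : A) * ((u * v : Aˣ) : A) * δ ↑u⁻¹ = v * v * (-δ u) := by
      rw [← hinv u, Units.val_mul, ← mul_assoc (v * v : A), hv]
      congr 1
      noncomm_ring
    have e2 : ((u * v : Aˣ) : A) * ((u * v : Aˣ) : A) * δ ↑v⁻¹ = u * u * (-δ v) := by
      rw [← hinv v, Units.val_mul, ← mul_assoc (u * u : A), hv]
      congr 1
      noncomm_ring
    rw [e1, e2, Units.val_mul, hv, mul_sub (u : A), map_sub, map_sub, hone, mul_one] at e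
    linear_combination (norm := noncomm_ring) -e
  obtain ⟨t, ht⟩ : ∃ t : ℝ, t = ‖x‖ * ‖(1 : A)‖ + 2 := ⟨_, rfl⟩
  have hpos : 0 ≤ ‖x‖ * ‖(1 : A)‖ := by positivity
  have hu : (t : ℂ) ∈ resolventSet ℂ (-x) := spectrum.mem_resolventSet_of_norm_lt_mul (by
    rw [norm_neg, Complex.norm_real, Real.norm_of_nonneg (by linarith)]; linarith)
  have hv : ((1 - t : ℝ) : ℂ) ∈ resolventSet ℂ x := spectrum.mem_resolventSet_of_norm_lt_mul (by
    rw [Complex.norm_real, Real.norm_of_nonpos (by linarith)]; linarith)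
  obtain ⟨u, hu⟩ := hu
  obtain ⟨v, hv⟩ := hv
  rw [Algebra.algebraMap_eq_smul_one] at hu hv
  have huv := hunit u v (by rw [hu, hv]; push_cast; module)
  rw [hu] at huv
  have e : ((t : ℂ) • (1 : A) - -x) * ((t : ℂ) • (1 : A) - -x)
      = ((t : ℂ) * t) • (1 : A) + (2 * t : ℂ) • x + x * x := by
    simp only [sub_neg_eq_add, mul_add, add_mul, smul_mul_assoc, mul_smul_comm, one_mul, mul_one]
    module
  have e' : ((t : ℂ) • (1 : A) - -x) * δ x = (t : ℂ) • δ x + x * δ x := by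
    simp [add_mul]
  rw [e] at huv
  simp only [map_add, map_sub, map_neg, map_smul, hone, smul_zero, zero_sub, neg_neg, zero_add,
    e'] at huv
  simp only [two_mul] at huv ⊢
  have : δ (x * x) = ((2 * t : ℂ) • δ x + δ (x * x)) - (2 * t : ℂ) • δ x := by abel
  rw [this, two_mul (t : ℂ), huv]
  module

end Banach

/-- On a unital semisimple Banach algebra, a continuous linear map which is left
derivable at `1` or Jordan left derivable at `1` is zero. -/
theorem stmt_7
    {A : Type*} [NormedRing A] [NormedAlgebra ℂ A] [CompleteSpace A]
    (hss : Ideal.jacobson (⊥ : Ideal A) = ⊥)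
    (δ : A →L[ℂ] A)
    (h : (∀ a b : A, a * b = 1 → δ (a * b) = a * δ b + b * δ a) ∨
      (∀ a b : A, a * b + b * a = 1 →
        δ (a * b + b * a) = 2 * (a * δ b) + 2 * (b * δ a))) :
    δ = 0 := by
  refine eq_zero_of_map_sq hss δ (map_sq_of_map_inverse δ fun u ↦ ?_)
  rcases h with h | h
  · have hone : δ 1 = 0 := by simpa using h 1 1 (one_mul 1)
    simpa [hone, eq_comm] using h u ↑u⁻¹ u.mul_inv
  · have key : ∀ v : Aˣ, (v : A) * δ ↑v⁻¹ + (↑v⁻¹ : A) * δ v = δ 1 := fun v ↦ by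
      have hsum : (v : A) * ((1 / 2 : ℂ) • (↑v⁻¹ : A)) + ((1 / 2 : ℂ) • (↑v⁻¹ : A)) * v = 1 := by
        simp only [mul_smul_comm, smul_mul_assoc, Units.mul_inv, Units.inv_mul]
        module
      have e := h v ((1 / 2 : ℂ) • (↑v⁻¹ : A)) hsum
      rw [hsum] at e
      rw [e, map_smul, mul_smul_comm, smul_mul_assoc, two_mul, two_mul]
      module
    have hone := key 1
    simp only [inv_one, Units.val_one, one_mul, add_eq_left] at hone
    rw [key, hone]
end

section
/- Let 𝒜 be a unital semisimple complex Banach algebra, let δ : 𝒜 → 𝒜 be a continuous linear map, and let W ∈ 𝒜 be a left separating point of 𝒜. If δ is left derivable at W, then δ = 0. -/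
section Density

variable {A X : Type*} [Ring A] [AddCommGroup X] [Module ℂ X] [Module A X] [IsSimpleModule A X]

/-- Jacobson density for a simple module whose endomorphisms are all scalar. -/
theorem exists_smul_eq_of_linearIndependent
    (hend : ∀ T : Module.End A X, ∃ z : ℂ, ∀ x, T x = z • x) {n : ℕ} {v : Fin n → X}
    (hv : LinearIndependent ℂ v) (w : Fin n → X) : ∃ c : A, ∀ i, c • v i = w i := by
  classical
  obtain ⟨g, hg⟩ := ((Module.Basis.span hv).constr ℂ w).exists_extend
  have hgv (i : Fin n) : g (v i) = w i := by
    have := LinearMap.congr_fun hg (Module.Basis.span hv i)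
    rwa [Module.Basis.constr_basis, LinearMap.comp_apply, Submodule.subtype_apply,
      Module.Basis.span_apply] at this
  let f : Module.End (Module.End A X) X :=
    { toFun := g
      map_add' := g.map_add
      map_smul' := fun T x ↦ by
        obtain ⟨z, hz⟩ := hend T
        simp [hz] }
  obtain ⟨c, hc⟩ := jacobson_density f (Finset.univ.image v)
  exact ⟨c, fun i ↦ by rw [← hgv i]; exact (hc (v i) (by simp)).symm⟩

variable [Algebra ℂ A] [IsScalarTower ℂ A X]

/-- If `[a, [a, b]]` annihilates a nonzero vector for every `b`, then `a` acts as the sum of a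
scalar and a square-zero operator. -/
theorem exists_scalar_sub_sq_eq_zero
    (hend : ∀ T : Module.End A X, ∃ z : ℂ, ∀ x, T x = z • x) {a : A} {x : X} (hx : x ≠ 0)
    (hax : ∀ b : A, a • a • b • x - (2 : ℂ) • a • b • a • x + b • a • a • x = 0) :
    ∃ z : ℂ, ∀ y : X, a • a • y - (2 * z) • a • y + (z * z) • y = 0 := by
  have hcomm (z : ℂ) (a : A) (x : X) : a • z • x = z • a • x := smul_algebra_smul_comm z a x
  by_cases h1 : ∃ z : ℂ, z • x = a • x
  · obtain ⟨z, hz⟩ := h1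
    refine ⟨z, fun y ↦ ?_⟩
    have hli : LinearIndependent ℂ ![x] := by
      simpa [linearIndependent_unique_iff] using hx
    obtain ⟨b, hb⟩ := exists_smul_eq_of_linearIndependent hend hli ![y]
    have hbx : b • x = y := hb 0
    have := hax b
    simp only [← hz, hcomm, hbx] at this
    generalize a • a • y = p at this ⊢
    generalize a • y = q at this ⊢
    linear_combination (norm := module) this
  · push Not at h1
    have hli := (LinearIndependent.pair_iff' hx).2 h1
    by_cases h2 : a • a • x ∈ Submodule.span ℂ (Set.range ![x, a • x])
    · simp only [Matrix.range_cons, Matrix.range_empty, Set.union_empty, Set.singleton_union,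
        Submodule.mem_span_pair] at h2
      obtain ⟨s, t, hst⟩ := h2
      exfalso
      obtain ⟨b, hb⟩ := exists_smul_eq_of_linearIndependent hend hli ![0, x]
      have hb0 : b • x = 0 := hb 0
      have hb1 : b • a • x = x := hb 1
      have := hax b
      simp only [← hst, smul_add, hcomm, hb0, hb1, smul_zero] at this
      refine h1 (t / 2) ?_
      generalize a • x = q at this ⊢
      linear_combination (norm := module) (1 / 2 : ℂ) • this
    · exfalso
      have hli3 : LinearIndependent ℂ ![a • a • x, x, a • x] :=
        linearIndependent_finCons.2 ⟨hli, h2⟩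
      obtain ⟨b, hb⟩ := exists_smul_eq_of_linearIndependent hend hli3 ![x, 0, 0]
      have hb0 : b • a • a • x = x := hb 0
      have hb1 : b • x = 0 := hb 1
      have hb2 : b • a • x = 0 := hb 2
      have := hax b
      simp only [hb0, hb1, hb2, smul_zero] at this
      exact hx (by simpa using this)

/-- A linear map into a simple module of dimension at least two vanishes if `[a, [a, b]]`
annihilates its value at `a` for all `a` and `b`. -/
theorem eq_zero_of_double_commutator_smul_eq_zero
    (hend : ∀ T : Module.End A X, ∃ z : ℂ, ∀ x, T x = z • x)
    (hdim : ∀ x : X, ∃ y : X, ∀ z : ℂ, z • x ≠ y) (d : A →ₗ[ℂ] X)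
    (hd : ∀ a b : A, (a * a * b - (2 : ℂ) • (a * b * a) + b * a * a) • d a = 0) (a : A) :
    d a = 0 := by
  have hcomm (z : ℂ) (a : A) (x : X) : a • z • x = z • a • x := smul_algebra_smul_comm z a x
  have key (a : A) (ha : d a ≠ 0) :
      ∃ z : ℂ, ∀ y : X, a • a • y - (2 * z) • a • y + (z * z) • y = 0 :=
    exists_scalar_sub_sq_eq_zero hend ha fun b ↦ by
      simpa only [add_smul, sub_smul, mul_smul, smul_assoc] using hd a b
  by_contra ha
  obtain ⟨z, hz⟩ := key a ha
  obtain ⟨x, y, e, hy, hxy, hay, hax⟩ : ∃ (x y : X) (e : ℂ), y ≠ 0 ∧ (∀ t : ℂ, t • y ≠ x) ∧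
      a • y = z • y ∧ a • x = z • x + e • y := by
    by_cases hN : ∀ x : X, a • x = z • x
    · obtain ⟨x, hx⟩ := hdim (d a)
      exact ⟨x, d a, 0, ha, hx, hN _, by simp [hN]⟩
    · push Not at hN
      obtain ⟨x, hx⟩ := hN
      have hy : a • (a • x - z • x) = z • (a • x - z • x) := by
        have := hz x
        rw [smul_sub, hcomm]
        generalize a • a • x = p at this ⊢
        generalize a • x = q at this ⊢
        linear_combination (norm := module) this
      refine ⟨x, a • x - z • x, 1, sub_ne_zero.2 hx, fun t ht ↦ hx ?_, hy,
        by rw [one_smul, add_sub_cancel]⟩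
      conv_lhs => rw [← ht]
      conv_rhs => rw [← ht]
      rw [hcomm, hy, smul_comm]
  obtain ⟨c, hc⟩ := exists_smul_eq_of_linearIndependent hend
    ((LinearIndependent.pair_iff' hy).2 hxy) ![0, x]
  have hcy : c • y = 0 := hc 0
  have hcx : c • x = x := hc 1
  have hx : x ≠ 0 := fun h ↦ hxy 0 (by simp [h])
  have hdc : d c = 0 := by
    by_contra hdc
    obtain ⟨m, hm⟩ := key c hdc
    have hmy := hm y
    have hmx := hm x
    simp only [hcy, smul_zero, sub_zero, zero_add, smul_eq_zero, hy, or_false,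
      mul_self_eq_zero] at hmy
    subst hmy
    exact hx (by simpa [hcx] using hmx)
  obtain ⟨m, hm⟩ := key (a + c) (by simpa [hdc] using ha)
  have hmy := hm y
  have hmx := hm x
  simp only [add_smul, smul_add, hcomm, hcy, hcx, hay, hax, add_zero] at hmy hmx
  have hmz : m = z := by
    have : ((m - z) * (m - z)) • y = 0 := by
      linear_combination (norm := module) hmy
    simpa [hy, sub_eq_zero] using this
  subst hmz
  refine hxy (-e) ?_
  linear_combination (norm := module) (-1 : ℂ) • hmx

end Density

open Filter Topology in
/-- Uniqueness of the first two coefficients of an expansion of zero with continuous remainder. -/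
theorem eq_zero_of_eventually_expansion_eq_zero {E : Type*} [NormedAddCommGroup E]
    [NormedSpace ℂ E] {x y : E} {r : ℂ → E} (hr : ContinuousAt r 0)
    (h : ∀ᶠ z in 𝓝 (0 : ℂ), z • x + z ^ 2 • y + z ^ 3 • r z = 0) :
    x = 0 ∧ y = 0 := by
  have h' : ∀ᶠ z in 𝓝[≠] (0 : ℂ), x + z • y + z ^ 2 • r z = 0 := by
    filter_upwards [h.filter_mono nhdsWithin_le_nhds, self_mem_nhdsWithin] with z hz hz0
    refine (smul_eq_zero.1 (?_ : z • (x + z • y + z ^ 2 • r z) = 0)).resolve_left hz0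
    linear_combination (norm := module) hz
  have hx : x = 0 := by
    have hc : ContinuousAt (fun z : ℂ ↦ x + z • y + z ^ 2 • r z) 0 := by fun_prop
    have := tendsto_nhds_unique_of_eventuallyEq (hc.tendsto.mono_left nhdsWithin_le_nhds)
      tendsto_const_nhds h'
    simpa using this
  refine ⟨hx, ?_⟩
  have hc : ContinuousAt (fun z : ℂ ↦ y + z • r z) 0 := by fun_prop
  have h'' : ∀ᶠ z in 𝓝[≠] (0 : ℂ), y + z • r z = 0 := by
    filter_upwards [h', self_mem_nhdsWithin] with z hz hz0
    refine (smul_eq_zero.1 (?_ : z • (y + z • r z) = 0)).resolve_left hz0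
    rw [hx] at hz
    linear_combination (norm := module) hz
  have := tendsto_nhds_unique_of_eventuallyEq (hc.tendsto.mono_left nhdsWithin_le_nhds)
      tendsto_const_nhds h''
  simpa using this

open Topology in
/-- A continuous linear map which is left derivable at a left separating point satisfies
`δ (a²) = 2 a δ a`. -/
theorem map_mul_self_of_leftDerivable {A : Type*} [NormedRing A] [NormedAlgebra ℂ A]
    [CompleteSpace A] (δ : A →L[ℂ] A) (W : A) (hsep : ∀ a : A, W * a = 0 → a = 0)
    (h : ∀ a b : A, a * b = W → δ (a * b) = a * δ b + b * δ a) (a : A) :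
    δ (a * a) = (2 : ℂ) • (a * δ a) := by
  have h1 : δ 1 = 0 := hsep _ (by simpa using h 1 W (one_mul W))
  let s : ℂ → A := fun z ↦ Ring.inverse (1 - z • a)
  have hs : ContinuousAt s 0 := by
    have h0 : ContinuousAt (Ring.inverse : A → A) (1 - (0 : ℂ) • a) := by
      simpa using NormedRing.inverse_continuousAt (1 : Aˣ)
    exact h0.comp (f := fun z : ℂ ↦ 1 - z • a) (by fun_prop)
  have hunit : ∀ᶠ z : ℂ in 𝓝 0, IsUnit (1 - z • a) := by
    have hc : ContinuousAt (fun z : ℂ ↦ 1 - z • a) 0 := by fun_prop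
    exact hc.eventually_mem (Units.isOpen.mem_nhds (by simp))
  have hexp : ∀ z : ℂ, IsUnit (1 - z • a) →
      s z = 1 + z • a + z ^ 2 • (a * a) + z ^ 3 • (a * a * a * s z) := by
    intro z hz
    have hz' : s z - z • (a * s z) = 1 := by
      simpa [s, sub_mul] using Ring.mul_inverse_cancel _ hz
    have e1 : s z = 1 + z • (a * s z) := by rw [← hz']; abel
    have e2 : a * s z = a + z • (a * a * s z) := by
      conv_lhs => rw [e1]
      simp [mul_add, mul_assoc]
    have e3 : a * a * s z = a * a + z • (a * a * a * s z) := by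
      conv_lhs => rw [e1]
      simp [mul_add, mul_assoc]
    linear_combination (norm := module) e1 + z • e2 + z ^ 2 • e3
  have hl := eq_zero_of_eventually_expansion_eq_zero
    (x := a * δ W - δ (a * W) + W * δ a)
    (y := a * a * δ W - a * δ (a * W) + W * δ (a * a) - a * W * δ a)
    (r := fun z ↦ a * a * a * s z * δ W - a * a * δ (a * W) - z • (a * a * a * s z * δ (a * W))
      + W * δ (a * a * a * s z) - a * W * δ (a * a) - z • (a * W * δ (a * a * a * s z)))
    (by fun_prop) (by
      filter_upwards [hunit] with z hz
      have := h (s z) ((1 - z • a) * W) (by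
        rw [← mul_assoc, Ring.inverse_mul_cancel _ hz, one_mul])
      rw [← mul_assoc, Ring.inverse_mul_cancel _ hz, one_mul] at this
      rw [hexp z hz] at this
      generalize a * a * a * s z = q at *
      simp only [add_mul, sub_mul, mul_add, mul_sub, one_mul, map_add, map_sub, map_smul,
        smul_mul_assoc, mul_smul_comm, h1, zero_add, smul_add, smul_sub, mul_assoc] at this ⊢
      linear_combination (norm := module) -this)
  have hr := eq_zero_of_eventually_expansion_eq_zero
    (x := W * δ a + a * δ W - δ (W * a))
    (y := W * δ (a * a) - W * a * δ a + a * a * δ W - a * δ (W * a))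
    (r := fun z ↦ W * δ (a * a * a * s z) - W * a * δ (a * a)
      - z • (W * a * δ (a * a * a * s z)) + a * a * a * s z * δ W - a * a * δ (W * a)
      - z • (a * a * a * s z * δ (W * a)))
    (by fun_prop) (by
      filter_upwards [hunit] with z hz
      have := h (W * (1 - z • a)) (s z) (by
        rw [mul_assoc, Ring.mul_inverse_cancel _ hz, mul_one])
      rw [mul_assoc, Ring.mul_inverse_cancel _ hz, mul_one] at this
      rw [hexp z hz] at this
      generalize a * a * a * s z = q at *
      simp only [add_mul, sub_mul, mul_add, mul_sub, one_mul, mul_one, map_add, map_sub, map_smul,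
        smul_mul_assoc, mul_smul_comm, h1, zero_add, smul_add, smul_sub, mul_assoc] at this ⊢
      linear_combination (norm := module) -this)
  obtain ⟨l1, l2⟩ := hl
  obtain ⟨r1, r2⟩ := hr
  rw [← sub_eq_zero]
  refine hsep _ ?_
  simp only [mul_sub, mul_smul_comm]
  linear_combination (norm := skip) 2 * r2 - l2 - 2 * a * r1 + a * l1
  simp only [two_smul]
  noncomm_ring

/-- Endomorphisms of `A ⧸ M` are scalar when `M` is a maximal left ideal of a Banach algebra. -/
theorem exists_eq_smul_of_end_quotient_maximal {A : Type*} [NormedRing A] [NormedAlgebra ℂ A]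
    [CompleteSpace A] (M : Ideal A) [hM : M.IsMaximal] (T : Module.End A (A ⧸ M)) :
    ∃ z : ℂ, ∀ x, T x = z • x := by
  have : IsSimpleModule A (A ⧸ M) := isSimpleModule_iff_isCoatom.2 hM.out
  have := IsSimpleModule.nontrivial A (A ⧸ M)
  have hcont : Continuous T := by
    obtain ⟨c, hc⟩ := M.mkQ_surjective (T (M.mkQ 1))
    have hT : T ∘ M.mkQ = M.mkQ ∘ (· * c) := by
      funext a
      have : M.mkQ a = a • M.mkQ 1 := by rw [← map_smul, smul_eq_mul, mul_one]
      simp only [Function.comp_apply]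
      rw [this, map_smul, ← hc, ← map_smul, smul_eq_mul]
    have hq : Topology.IsQuotientMap M.mkQ := isQuotientMap_quot_mk
    rw [hq.continuous_iff, hT]
    exact hq.continuous.comp (by fun_prop)
  let S : (A ⧸ M) →L[ℂ] (A ⧸ M) := ⟨T.restrictScalars ℂ, hcont⟩
  obtain ⟨z, hz⟩ := spectrum.nonempty S
  refine ⟨z, ?_⟩
  let U : Module.End A (A ⧸ M) :=
    { toFun := fun x ↦ z • x - T x
      map_add' := fun x y ↦ by rw [map_add, smul_add]; abel
      map_smul' := fun a x ↦ by
        rw [map_smul, RingHom.id_apply, smul_sub, ← smul_algebra_smul_comm z a x] }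
  rcases U.bijective_or_eq_zero with hU | hU
  · refine absurd ?_ hz
    exact ContinuousLinearMap.isUnit_iff_bijective.2 hU
  · exact fun x ↦ (sub_eq_zero.1 (LinearMap.congr_fun hU x)).symm

/-- A linear map satisfying `δ (a²) = 2 a δ a` satisfies `[a, [a, b]] δ a = 0`. -/
theorem double_commutator_mul_eq_zero {A : Type*} [Ring A] [Algebra ℂ A] (δ : A →ₗ[ℂ] A)
    (hδ : ∀ a, δ (a * a) = (2 : ℂ) • (a * δ a)) (a b : A) :
    (a * a * b - (2 : ℂ) • (a * b * a) + b * a * a) * δ a = 0 := by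
  have lin (x y : A) : δ (x * y) + δ (y * x) = 2 * (x * δ y) + 2 * (y * δ x) := by
    have := hδ (x + y)
    simp only [add_mul, mul_add, map_add, hδ, smul_add, two_smul] at this
    linear_combination (norm := noncomm_ring) this
  have sq (x : A) : δ (x * x) = 2 * (x * δ x) := by rw [hδ, two_smul, two_mul]
  have two {x : A} (h : 2 * x = 0) : x = 0 := by
    rw [two_mul, ← two_smul ℂ] at h
    exact (smul_eq_zero.1 h).resolve_left two_ne_zero
  have triple (x y : A) :
      δ (x * (y * x)) = x * (x * δ y) + 3 * (x * (y * δ x)) - y * (x * δ x) := by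
    rw [← sub_eq_zero]
    refine two ?_
    have h1 := lin x (x * y + y * x)
    have h2 := lin (x * x) y
    simp only [add_mul, mul_add, map_add, mul_assoc, sq] at h1 h2
    linear_combination (norm := noncomm_ring) h1 - h2 + 2 * x * lin x y
  have triple' (x y z : A) : δ (x * (y * z)) + δ (z * (y * x)) = x * (z * δ y) + z * (x * δ y)
      + 3 * (x * (y * δ z)) + 3 * (z * (y * δ x)) - y * (x * δ z) - y * (z * δ x) := by
    have h1 := triple (x + z) y
    simp only [add_mul, mul_add, map_add] at h1
    linear_combination (norm := noncomm_ring) h1 - triple x y - triple z y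
  have comm (x y : A) : (x * y - y * x) * δ (x * y)
      = x * (x * y - y * x) * δ y + y * (x * y - y * x) * δ x := by
    have h1 := triple' x y (x * y)
    have h2 := sq (x * y)
    have h3 := triple x (y * y)
    simp only [mul_assoc, sq] at h1 h2 h3
    linear_combination (norm := noncomm_ring) h2 + h3 - h1
  have h1 := comm a (a + b)
  have h2 := comm a b
  refine two ?_
  simp only [mul_add, map_add, sq, two_smul] at h1 ⊢
  linear_combination (norm := noncomm_ring) h2 - h1

/-- A linear map satisfying `δ (a²) = 2 a δ a` obeys the left Leibniz rule on commuting pairs. -/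
theorem map_mul_of_commute {A : Type*} [Ring A] [Algebra ℂ A] (δ : A →ₗ[ℂ] A)
    (hδ : ∀ a, δ (a * a) = (2 : ℂ) • (a * δ a)) {x y : A} (hxy : Commute x y) :
    δ (x * y) = x * δ y + y * δ x := by
  have := hδ (x + y)
  simp only [add_mul, mul_add, map_add, hδ, smul_add, ← hxy.eq] at this
  linear_combination (norm := module) (1 / 2 : ℂ) • this

/-- Iterated Leibniz rule on powers, up to terms of higher order in `a`. -/
theorem exists_iterate_map_pow_eq {A : Type*} [Ring A] [Algebra ℂ A] (δ : A →ₗ[ℂ] A)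
    (hδ : ∀ a, δ (a * a) = (2 : ℂ) • (a * δ a)) (hc : ∀ x y, Commute (δ x) y) (a : A) (k m : ℕ) :
    ∃ c, Commute c a ∧ δ^[k] (a ^ (m + k)) =
      ((m + k).descFactorial k : ℂ) • (a ^ m * δ a ^ k) + a ^ (m + 1) * c := by
  have hpow (n : ℕ) : δ (a ^ (n + 1)) = ((n + 1 : ℕ) : ℂ) • (a ^ n * δ a) := by
    induction n with
    | zero => simp
    | succ n ih =>
      rw [pow_succ', map_mul_of_commute δ hδ (Commute.self_pow a (n + 1)), ih, mul_smul_comm,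
        ← mul_assoc, ← pow_succ']
      push_cast
      module
  induction k generalizing m with
  | zero => exact ⟨0, Commute.zero_left a, by simp⟩
  | succ k ih =>
    obtain ⟨c, hca, h⟩ := ih (m + 1)
    refine ⟨((m + 1 + k).descFactorial k : ℂ) • δ (δ a ^ k) + ((m + 2 : ℕ) : ℂ) • (c * δ a) +
      a * δ c, ?_, ?_⟩
    · exact (((hc _ a).smul_left _).add_left ((hca.mul_left (hc _ a)).smul_left _)).add_left
        ((Commute.refl a).mul_left (hc _ a))
    · rw [Function.iterate_succ_apply', show m + (k + 1) = m + 1 + k by ring, h, map_add, map_smul,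
        map_mul_of_commute δ hδ ((hc a _).symm.pow_right k),
        map_mul_of_commute δ hδ (hca.symm.pow_left _), hpow, hpow,
        Nat.descFactorial_succ, show m + 1 + k - k = m + 1 by lia]
      have e1 : δ a ^ k * (a ^ m * δ a) = a ^ m * δ a ^ (k + 1) := by
        rw [← mul_assoc, ((hc a (a ^ m)).pow_left k).eq, mul_assoc, pow_succ]
      have e2 : c * (a ^ (m + 1) * δ a) = a ^ (m + 1) * (c * δ a) := by
        rw [← mul_assoc, (hca.pow_right _).eq, mul_assoc]
      simp only [mul_smul_comm, e1, e2, mul_add, pow_succ a (m + 1), mul_assoc]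
      push_cast
      module

/-- A left ideal of codimension one is also a right ideal. -/
theorem mul_mem_of_exists_sub_smul_mem {A : Type*} [Ring A] [Algebra ℂ A]
    {M : Ideal A} (hM : ∀ a, ∃ z : ℂ, a - z • 1 ∈ M) {m : A} (hm : m ∈ M) (a : A) : m * a ∈ M := by
  obtain ⟨z, hz⟩ := hM a
  have := M.add_mem (M.mul_mem_left m hz) (M.mul_mem_left (z • 1) hm)
  simpa [mul_sub] using this

section Banach

variable {A : Type*} [NormedRing A] [NormedAlgebra ℂ A] [CompleteSpace A]

/-- For a maximal left ideal `M`, either every value of `δ` annihilates `A ⧸ M`, or `M` has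
codimension one. -/
theorem map_mul_mem_or_exists_sub_smul_mem (δ : A →ₗ[ℂ] A)
    (hδ : ∀ a, δ (a * a) = (2 : ℂ) • (a * δ a)) (M : Ideal A) [hM : M.IsMaximal] :
    (∀ a b, δ a * b ∈ M) ∨ ∀ a, ∃ z : ℂ, a - z • 1 ∈ M := by
  have : IsSimpleModule A (A ⧸ M) := isSimpleModule_iff_isCoatom.2 hM.out
  by_cases hdim : ∀ x : A ⧸ M, ∃ y : A ⧸ M, ∀ z : ℂ, z • x ≠ y
  · refine Or.inl fun a b ↦ ?_
    have := eq_zero_of_double_commutator_smul_eq_zero (exists_eq_smul_of_end_quotient_maximal M)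
      hdim (((LinearMap.toSpanSingleton A (A ⧸ M) (M.mkQ b)).restrictScalars ℂ).comp δ)
      (fun a c ↦ by
        simp only [LinearMap.comp_apply, LinearMap.restrictScalars_apply,
          LinearMap.toSpanSingleton_apply]
        rw [← mul_smul, double_commutator_mul_eq_zero δ hδ, zero_smul]) a
    simp only [LinearMap.comp_apply, LinearMap.restrictScalars_apply,
      LinearMap.toSpanSingleton_apply, ← map_smul, smul_eq_mul] at this
    exact (Submodule.Quotient.mk_eq_zero M).1 this
  · push Not at hdim
    obtain ⟨x, hx⟩ := hdim
    refine Or.inr fun a ↦ ?_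
    obtain ⟨s, hs⟩ := hx (Submodule.Quotient.mk 1)
    obtain ⟨t, ht⟩ := hx (Submodule.Quotient.mk a)
    have hs0 : s ≠ 0 := by
      rintro rfl
      rw [zero_smul] at hs
      exact hM.ne_top ((Ideal.eq_top_iff_one M).2 ((Submodule.Quotient.mk_eq_zero M).1 hs.symm))
    refine ⟨t / s, (Submodule.Quotient.eq M).1 ?_⟩
    rw [Submodule.Quotient.mk_smul, ← hs, ← ht, smul_smul, div_mul_cancel₀ t hs0]

/-- Values of `δ` are central in a semisimple Banach algebra. -/
theorem commute_map (hss : Ideal.jacobson (⊥ : Ideal A) = ⊥) (δ : A →ₗ[ℂ] A)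
    (hδ : ∀ a, δ (a * a) = (2 : ℂ) • (a * δ a)) (x y : A) : Commute (δ x) y := by
  refine sub_eq_zero.1 ((Submodule.mem_bot A).1 ?_)
  rw [← hss]
  refine Submodule.mem_sInf.2 fun (M : Ideal A) hM ↦ ?_
  have := hM.2
  rcases map_mul_mem_or_exists_sub_smul_mem δ hδ M with h | h
  · exact M.sub_mem (h x y) (M.mul_mem_left y (by simpa using h x 1))
  · obtain ⟨s, hs⟩ := h (δ x)
    obtain ⟨t, ht⟩ := h y
    have := M.sub_mem (M.mul_mem_left (δ x - s • 1) ht) (M.mul_mem_left (y - t • 1) hs)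
    convert this using 1
    simp only [mul_sub, sub_mul, smul_mul_assoc, mul_smul_comm, one_mul, mul_one]
    module

/-- A continuous linear map with central values satisfying `δ (a²) = 2 a δ a` maps a proper left
ideal of codimension one into itself. -/
theorem map_mem_of_exists_sub_smul_mem (δ : A →L[ℂ] A)
    (hδ : ∀ a, δ (a * a) = (2 : ℂ) • (a * δ a)) (hc : ∀ x y, Commute (δ x) y) {M : Ideal A}
    (hM : M ≠ ⊤) (hcodim : ∀ a, ∃ z : ℂ, a - z • 1 ∈ M) {a : A} (ha : a ∈ M) : δ a ∈ M := by
  obtain ⟨z, hz⟩ := hcodim (δ a)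
  rcases eq_or_ne z 0 with rfl | hz0
  · simpa using hz
  exfalso
  have hpow (n : ℕ) : δ a ^ n - z ^ n • 1 ∈ M := by
    induction n with
    | zero => simp
    | succ n ih =>
      have := M.add_mem (M.mul_mem_left (δ a ^ n) hz) (M.mul_mem_left (z • 1) ih)
      convert this using 1
      simp only [mul_sub, smul_mul_assoc, mul_smul_comm, one_mul, mul_one, pow_succ, smul_smul]
      module
  have hnorm (n : ℕ) (x : A) : ‖δ^[n] x‖ ≤ ‖δ‖ ^ n * ‖x‖ := by
    induction n with
    | zero => simp
    | succ n ih =>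
      rw [Function.iterate_succ_apply', pow_succ', mul_assoc]
      exact (δ.le_opNorm _).trans (by gcongr)
  have hlim := FloorSemiring.tendsto_pow_div_factorial_atTop (‖δ‖ * ‖a‖ / ‖z‖)
  obtain ⟨n, hn, hn1⟩ :=
    ((hlim.eventually_lt_const one_pos).and (Filter.eventually_ge_atTop 1)).exists
  obtain ⟨c, -, h⟩ := exists_iterate_map_pow_eq δ.toLinearMap hδ hc a n 0
  simp only [zero_add, Nat.descFactorial_self, pow_zero, one_mul, pow_one,
    ContinuousLinearMap.coe_coe] at h
  have hr : (n.factorial : ℂ) * z ^ n ≠ 0 :=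
    mul_ne_zero (Nat.cast_ne_zero.2 n.factorial_ne_zero) (pow_ne_zero n hz0)
  refine hM (M.eq_top_of_norm_lt_one
    (x := 1 - ((n.factorial : ℂ) * z ^ n)⁻¹ • δ^[n] (a ^ n)) ?_ ?_)
  · have hmem := M.add_mem (M.mul_mem_left ((n.factorial : ℂ) • 1) (hpow n))
      (mul_mem_of_exists_sub_smul_mem hcodim ha c)
    have := M.mul_mem_left ((-((n.factorial : ℂ) * z ^ n)⁻¹) • 1) hmem
    convert this using 1
    have e : (1 : A) = (((n.factorial : ℂ) * z ^ n)⁻¹ * ((n.factorial : ℂ) * z ^ n)) • 1 := by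
      rw [inv_mul_cancel₀ hr, one_smul]
    conv_lhs => rw [e, h]
    simp only [mul_sub, mul_add, smul_mul_assoc, mul_smul_comm, one_mul, mul_one]
    module
  · rw [sub_sub_cancel, norm_smul, norm_inv, norm_mul, norm_pow, Complex.norm_natCast]
    refine lt_of_le_of_lt ?_ hn
    calc _ ≤ ((n.factorial : ℝ) * ‖z‖ ^ n)⁻¹ * (‖δ‖ ^ n * ‖a‖ ^ n) := by
          gcongr
          exact (hnorm n _).trans (by gcongr; exact norm_pow_le' a hn1)
      _ = _ := by
          rw [div_pow, mul_pow]
          field_simp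

end Banach

/-- On a unital semisimple Banach algebra, a continuous linear map which is left
derivable at a left separating point `W` is zero. -/
theorem stmt_8
    {A : Type*} [NormedRing A] [NormedAlgebra ℂ A] [CompleteSpace A]
    (hss : Ideal.jacobson (⊥ : Ideal A) = ⊥)
    (δ : A →L[ℂ] A) (W : A) (hsep : ∀ a : A, W * a = 0 → a = 0)
    (h : ∀ a b : A, a * b = W → δ (a * b) = a * δ b + b * δ a) :
    δ = 0 := by
  have hδ := map_mul_self_of_leftDerivable δ W hsep h
  have h1 : δ 1 = 0 := hsep _ (by simpa using h 1 W (one_mul W))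
  ext a
  refine (Submodule.mem_bot A).1 ?_
  rw [← hss]
  refine Submodule.mem_sInf.2 fun M hM ↦ ?_
  have := hM.2
  rcases map_mul_mem_or_exists_sub_smul_mem δ.toLinearMap hδ M with hM' | hM'
  · simpa using hM' a 1
  · obtain ⟨z, hz⟩ := hM' a
    have := map_mem_of_exists_sub_smul_mem δ hδ (commute_map hss δ.toLinearMap hδ)
      this.ne_top hM' hz
    simpa [h1] using this
end

section
/- Let 𝒜 be a unital semisimple complex Banach algebra, let δ : 𝒜 → 𝒜 be a continuous linear map, and let W be an element of the centre Z(𝒜) of 𝒜 which is a left separating point of 𝒜. If δ is Jordan left derivable at W, then δ = 0. -/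
open Filter Topology Module

section Algebra

variable {A : Type*} [Ring A] [Algebra ℂ A]

lemma eq_zero_of_two_mul_eq_zero {a : A} (ha : 2 * a = 0) : a = 0 := by
  have h2 : (2 : ℂ) • a = 0 := by rw [two_smul, ← two_mul, ha]
  exact (smul_eq_zero_iff_right (two_ne_zero)).1 h2

/-- A Jordan left derivation: a linear map satisfying `δ (x ^ 2) = 2 x δ x`. -/
def IsJordanLeftDerivation (δ : A →ₗ[ℂ] A) : Prop :=
  ∀ x, δ (x * x) = 2 * (x * δ x)

namespace IsJordanLeftDerivation

variable {δ : A →ₗ[ℂ] A} (hδ : IsJordanLeftDerivation δ)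
include hδ

lemma map_mul_add_mul (x y : A) :
    δ (x * y + y * x) = 2 * (x * δ y) + 2 * (y * δ x) := by
  have h1 := hδ (x + y)
  have h2 : (x + y) * (x + y) = x * x + y * y + (x * y + y * x) := by noncomm_ring
  rw [h2, map_add, map_add, hδ, hδ] at h1
  simp only [map_add] at h1 ⊢
  rw [← sub_eq_zero] at h1 ⊢
  rw [← h1]
  noncomm_ring

lemma two_mul_map_mul_mul (x y : A) :
    2 * δ (x * y * x) =
      2 * (x * x * δ y) + 6 * (x * y * δ x) - 2 * (y * x * δ x) := by
  have h1 := hδ.map_mul_add_mul x (x * y + y * x)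
  have h2 := hδ.map_mul_add_mul (x * x) y
  have h3 : x * (x * y + y * x) + (x * y + y * x) * x =
      (x * x * y + y * (x * x)) + (x * y * x + x * y * x) := by noncomm_ring
  rw [h3, map_add, h2, map_add, hδ.map_mul_add_mul x y, hδ x] at h1
  rw [← sub_eq_zero] at h1 ⊢
  rw [← h1]
  noncomm_ring

lemma double_commutator_mul (x y : A) :
    (x * x * y - 2 * (x * y * x) + y * (x * x)) * δ x = 0 := by
  apply eq_zero_of_two_mul_eq_zero
  have h1 := hδ.two_mul_map_mul_mul x (x * y + y * x)
  have h2 := hδ.map_mul_add_mul x (x * y * x)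
  have h3 : x * (x * y * x) + x * y * x * x = x * (x * y + y * x) * x := by noncomm_ring
  have h4 := hδ.two_mul_map_mul_mul x y
  rw [h3] at h2
  rw [h2, hδ.map_mul_add_mul x y] at h1
  have h5 : 2 * (x * (2 * δ (x * y * x))) = 2 * (2 * (x * δ (x * y * x))) := by noncomm_ring
  rw [mul_add, ← h5, h4] at h1
  rw [← sub_eq_zero] at h1
  rw [← h1]
  noncomm_ring

lemma map_one : δ 1 = 0 := by
  have h := hδ 1
  rw [one_mul, one_mul, two_mul] at h
  simpa using h

lemma map_mul_of_commute {x c : A} (hc : Commute x c) :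
    δ (x * c) = x * δ c + c * δ x := by
  have h := hδ.map_mul_add_mul x c
  rw [← hc.eq, ← two_mul] at h
  have h2 : δ (2 * (x * c)) = 2 * δ (x * c) := by rw [two_mul, two_mul, map_add]
  rw [h2, ← mul_add, ← sub_eq_zero, ← mul_sub] at h
  exact sub_eq_zero.1 (eq_zero_of_two_mul_eq_zero h)

lemma map_pow_succ_mul_of_commute {x : A} (n : ℕ) {c : A} (hc : Commute x c) :
    δ (x ^ (n + 1) * c) = x ^ n * ((n + 1 : ℂ) • (c * δ x) + x * δ c) := by
  induction n generalizing c with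
  | zero => simp [hδ.map_mul_of_commute hc, add_comm]
  | succ n ih =>
    rw [pow_succ, mul_assoc, ih ((Commute.refl x).mul_right hc), hδ.map_mul_of_commute hc,
      pow_succ x n, mul_assoc]
    push_cast
    simp only [mul_add, mul_smul_comm, add_smul, one_smul, mul_assoc]
    abel

variable {V : Type*} [AddCommGroup V] [Module ℂ V] [Module A V] [IsScalarTower ℂ A V]

/-- If `x` kills `v` and `δ x` acts on `v` as the scalar `k`, then `δⁿ (xⁿ)` acts on `v`
as `n! kⁿ`. -/
lemma iterate_pow_mul_smul (hcen : ∀ a b, Commute (δ a) b) {x : A} {v : V} {k : ℂ}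
    (hx : x • v = 0) (hk : δ x • v = k • v) (n : ℕ) {c : A} (hc : Commute x c) :
    (δ^[n] (x ^ n * c)) • v = ((n.factorial : ℂ) * k ^ n) • c • v := by
  induction n generalizing c with
  | zero => simp
  | succ n ih =>
    have hcomm : Commute x ((n + 1 : ℂ) • (c * δ x) + x * δ c) :=
      ((hc.mul_right (hcen x x).symm).smul_right _).add_right
        ((Commute.refl x).mul_right (hcen c x).symm)
    have hxc : (x * δ c) • v = 0 := by rw [← (hcen c x).eq, mul_smul, hx, smul_zero]
    rw [Function.iterate_succ_apply, hδ.map_pow_succ_mul_of_commute n hc, ih hcomm,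
      add_smul, hxc, add_zero, smul_assoc, mul_smul c, hk,
      smul_algebra_smul_comm k c, smul_smul, smul_smul, Nat.factorial_succ]
    congr 1
    push_cast
    ring

end IsJordanLeftDerivation

end Algebra

section Simple

variable {A : Type*} [Ring A] [Algebra ℂ A]
  {V : Type*} [AddCommGroup V] [Module ℂ V] [Module A V] [IsScalarTower ℂ A V]

omit [Algebra ℂ A] [IsScalarTower ℂ A V] in
/-- Jacobson density for a simple module whose endomorphisms are the complex scalars. -/
lemma exists_smul_eq_of_linearIndependent_s9 [IsSimpleModule A V]
    (hS : ∀ T : V →ₗ[A] V, ∃ k : ℂ, ∀ v, T v = k • v)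
    {n : ℕ} {v : Fin n → V} (hv : LinearIndependent ℂ v) (u : Fin n → V) :
    ∃ a : A, ∀ i, a • v i = u i := by
  classical
  obtain ⟨g, hg⟩ : ∃ g : V →ₗ[ℂ] V, ∀ i, g (v i) = u i := by
    obtain ⟨g, hg⟩ := ((Basis.span hv).constr ℂ u).exists_extend
    refine ⟨g, fun i ↦ ?_⟩
    have h1 := congr($hg (Basis.span hv i))
    rw [Basis.constr_basis] at h1
    rw [← h1]
    simp [Basis.span_apply]
  let f : End (End A V) V :=
    { toFun := g
      map_add' := map_add g
      map_smul' := fun T w ↦ by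
        obtain ⟨k, hk⟩ := hS T
        simp [hk] }
  obtain ⟨a, ha⟩ := jacobson_density f (Finset.univ.image v)
  exact ⟨a, fun i ↦ by rw [← ha (v i) (by simp), ← hg]; rfl⟩

omit [Algebra ℂ A] [IsScalarTower ℂ A V] in
lemma exists_smul_eq_pair [IsSimpleModule A V]
    (hS : ∀ T : V →ₗ[A] V, ∃ k : ℂ, ∀ v, T v = k • v)
    {v w : V} (h : LinearIndependent ℂ ![v, w]) (u t : V) :
    ∃ a : A, a • v = u ∧ a • w = t := by
  obtain ⟨a, ha⟩ := exists_smul_eq_of_linearIndependent_s9 hS h ![u, t]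
  exact ⟨a, ha 0, ha 1⟩

namespace IsJordanLeftDerivation

variable {δ : A →ₗ[ℂ] A} (hδ : IsJordanLeftDerivation δ)
include hδ

omit [IsScalarTower ℂ A V] in
lemma double_commutator_smul (x y : A) (v : V) :
    x • x • y • δ x • v - (2 : ℂ) • x • y • x • δ x • v + y • x • x • δ x • v = 0 := by
  have h := congr($(hδ.double_commutator_mul x y) • v)
  rw [zero_smul] at h
  rw [← h, two_smul, two_mul]
  simp only [add_mul, sub_mul, add_smul, sub_smul, mul_smul]

variable [IsSimpleModule A V] (hS : ∀ T : V →ₗ[A] V, ∃ k : ℂ, ∀ v, T v = k • v)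
include hS

lemma exists_smul_map_smul_eq {x : A} {v : V} (hv : δ x • v ≠ 0) :
    ∃ k : ℂ, x • δ x • v = k • δ x • v := by
  have key := fun y ↦ hδ.double_commutator_smul x y v
  set w := δ x • v
  by_contra! hne
  have hpair : LinearIndependent ℂ ![w, x • w] :=
    (LinearIndependent.pair_iff' hv).2 fun k hk ↦ hne k hk.symm
  by_cases hspan : x • x • w ∈ Submodule.span ℂ {w, x • w}
  · obtain ⟨a, b, hab⟩ := Submodule.mem_span_pair.1 hspan
    obtain ⟨y, hy1, hy2⟩ := exists_smul_eq_pair hS hpair 0 w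
    have h := key y
    rw [← hab, hy1, hy2, smul_add, smul_algebra_smul_comm, smul_algebra_smul_comm, hy1, hy2]
      at h
    simp only [smul_zero, zero_sub, zero_add] at h
    refine hne (b / 2) ?_
    have h' : (2 : ℂ) • x • w = b • w := by rwa [neg_add_eq_zero] at h
    rw [div_eq_inv_mul, mul_smul, ← h', inv_smul_smul₀ two_ne_zero]
  · have htriple : LinearIndependent ℂ ![x • x • w, w, x • w] := by
      refine linearIndependent_finCons.2 ⟨hpair, ?_⟩
      simpa [Set.pair_comm] using hspan
    obtain ⟨y, hy⟩ := exists_smul_eq_of_linearIndependent_s9 hS htriple ![w, 0, 0]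
    have h := key y
    rw [show y • x • x • w = w from hy 0, show y • w = 0 from hy 1,
      show y • x • w = 0 from hy 2] at h
    exact hv (by simpa using h)

lemma exists_quadratic {x : A} {v : V} (hv : δ x • v ≠ 0) :
    ∃ k : ℂ, ∀ u : V, x • x • u - (2 * k) • x • u + (k * k) • u = 0 := by
  obtain ⟨k, hk⟩ := hδ.exists_smul_map_smul_eq hS hv
  refine ⟨k, fun u ↦ ?_⟩
  obtain ⟨y, rfl⟩ := IsSimpleModule.toSpanSingleton_surjective A hv u
  have h := hδ.double_commutator_smul x y v
  rw [hk, smul_algebra_smul_comm k x, hk, smul_algebra_smul_comm k y, smul_algebra_smul_comm k y,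
    smul_algebra_smul_comm k y, smul_algebra_smul_comm k x, smul_smul, smul_smul k k] at h
  simpa only [LinearMap.toSpanSingleton_apply, mul_smul] using h

lemma eigenvalue_unique {x : A} {v : V} (hv : δ x • v ≠ 0) :
    ∃ k : ℂ, ∀ (u : V) (m : ℂ), u ≠ 0 → x • u = m • u → m = k := by
  obtain ⟨k, hk⟩ := hδ.exists_quadratic hS hv
  refine ⟨k, fun u m hu hm ↦ ?_⟩
  have h := hk u
  rw [hm, smul_algebra_smul_comm, hm, smul_smul, smul_smul, ← sub_smul, ← add_smul,
    smul_eq_zero_iff_left hu] at h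
  have h2 : (m - k) ^ 2 = 0 := by rw [← h]; ring
  exact sub_eq_zero.1 (pow_eq_zero_iff two_ne_zero |>.1 h2)

lemma not_linearIndependent_pair {x : A} {v : V} (hv : δ x • v ≠ 0) (p q : V) :
    ¬ LinearIndependent ℂ ![p, q] := by
  intro hpq
  obtain ⟨k, hk⟩ := hδ.exists_quadratic hS hv
  obtain ⟨r, s, c, hrs, hr, hs⟩ : ∃ (r s : V) (c : ℂ), LinearIndependent ℂ ![r, s] ∧
      x • r = k • r + c • s ∧ x • s = k • s := by
    have main (r : V) (hr : r ≠ 0) (hn : x • r ≠ k • r) :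
        LinearIndependent ℂ ![r, x • r - k • r] := by
      refine (LinearIndependent.pair_iff' hr).2 fun m hm ↦ hn ?_
      have hm' : x • r = (m + k) • r := by rw [add_smul, hm, sub_add_cancel]
      have h := hk r
      rw [hm', smul_algebra_smul_comm, hm', smul_smul, smul_smul, ← sub_smul, ← add_smul,
        smul_eq_zero_iff_left hr] at h
      have h2 : m ^ 2 = 0 := by rw [← h]; ring
      rw [hm', pow_eq_zero_iff two_ne_zero |>.1 h2, zero_add]
    have heig (r : V) : x • (x • r - k • r) = k • (x • r - k • r) := by
      rw [← sub_eq_zero, ← hk r, smul_sub, smul_sub, smul_algebra_smul_comm, smul_smul,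
        smul_smul, two_mul, add_smul]
      abel
    have hp : p ≠ 0 := hpq.ne_zero 0
    have hq : q ≠ 0 := hpq.ne_zero 1
    by_cases hxp : x • p = k • p
    · by_cases hxq : x • q = k • q
      · exact ⟨p, q, 0, hpq, by simp [hxp], hxq⟩
      · exact ⟨q, _, 1, main q hq hxq, by simp, heig q⟩
    · exact ⟨p, _, 1, main p hp hxp, by simp, heig p⟩
  have hr0 : r ≠ 0 := hrs.ne_zero 0
  have hs0 : s ≠ 0 := hrs.ne_zero 1
  obtain ⟨y, hyr, hys⟩ := exists_smul_eq_pair hS hrs 0 s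
  have hy : δ y • v = 0 := by
    by_contra hy
    obtain ⟨m, hm⟩ := hδ.eigenvalue_unique hS hy
    have h0 := hm r 0 hr0 (by simp [hyr])
    have h1 := hm s 1 hs0 (by simp [hys])
    exact zero_ne_one (h0.trans h1.symm)
  have hz : δ (x + y) • v ≠ 0 := by rwa [map_add, add_smul, hy, add_zero]
  obtain ⟨m, hm⟩ := hδ.eigenvalue_unique hS hz
  have h1 := hm s (k + 1) hs0 (by rw [add_smul, hs, hys, add_smul, one_smul])
  have hne : r - c • s ≠ 0 := by
    intro h
    have h' := LinearIndependent.pair_iff.1 hrs 1 (-c) (by simpa [sub_eq_add_neg] using h)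
    exact one_ne_zero h'.1
  have h0 := hm (r - c • s) k hne (by
    rw [add_smul, smul_sub, smul_sub, smul_algebra_smul_comm, smul_algebra_smul_comm, hr, hs,
      hyr, hys, smul_sub, smul_comm k c s]
    abel)
  have : k + 1 = k := h1.trans h0.symm
  simp at this

lemma exists_smul_eq_of_map_smul_ne_zero {x : A} {v : V} (hv : δ x • v ≠ 0) (a : A) {u : V}
    (hu : u ≠ 0) : ∃ k : ℂ, a • u = k • u := by
  by_contra! h
  exact hδ.not_linearIndependent_pair hS hv u (a • u)
    ((LinearIndependent.pair_iff' hu).2 fun k hk ↦ h k hk.symm)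

lemma commutator_smul (x y : A) {u : V} (hu : u ≠ 0) : (δ x * y - y * δ x) • u = 0 := by
  by_cases hz : ∀ v : V, δ x • v = 0
  · simp [sub_smul, mul_smul, hz]
  · push Not at hz
    obtain ⟨v, hv⟩ := hz
    obtain ⟨k, hk⟩ := hδ.exists_smul_eq_of_map_smul_ne_zero hS hv (δ x) hu
    obtain ⟨m, hm⟩ := hδ.exists_smul_eq_of_map_smul_ne_zero hS hv y hu
    rw [sub_smul, mul_smul, mul_smul, hk, hm, smul_algebra_smul_comm, smul_algebra_smul_comm,
      hk, hm, smul_comm, sub_self]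

end IsJordanLeftDerivation

end Simple

section Banach

variable {A : Type*} [NormedRing A] [NormedAlgebra ℂ A] [CompleteSpace A]

/-- Schur's lemma for the simple quotients of a complex Banach algebra. -/
lemma exists_endomorphism_eq_smul (M : Ideal A) [M.IsMaximal] (T : (A ⧸ M) →ₗ[A] (A ⧸ M)) :
    ∃ k : ℂ, ∀ v, T v = k • v := by
  have : IsSimpleModule A (A ⧸ M) := isSimpleModule_iff_isCoatom.2 (Ideal.IsMaximal.out)
  have : Nontrivial (A ⧸ M) := IsSimpleModule.nontrivial A _
  have hcont : Continuous T := by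
    refine M.isQuotientMap_mkQ.continuous_iff.2 ?_
    obtain ⟨t, ht⟩ := M.mkQ_surjective (T (M.mkQ 1))
    have : T ∘ M.mkQ = fun a ↦ M.mkQ (a * t) := by
      ext a
      rw [← smul_eq_mul, map_smul, ht, ← map_smul, ← map_smul, smul_eq_mul, mul_one]
      rfl
    rw [this]
    exact M.isQuotientMap_mkQ.continuous.comp (continuous_mul_const t)
  let S : (A ⧸ M) →L[ℂ] (A ⧸ M) := ⟨T.restrictScalars ℂ, hcont⟩
  obtain ⟨k, hk⟩ := spectrum.nonempty S
  have hker : ∀ v, (algebraMap ℂ ((A ⧸ M) →L[ℂ] (A ⧸ M)) k - S) v = k • v - T v := fun v ↦ by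
    simp only [Algebra.algebraMap_eq_smul_one, sub_apply,
      smul_apply, one_apply_eq_self]
    rfl
  let D : (A ⧸ M) →ₗ[A] (A ⧸ M) :=
    { toFun := fun v ↦ k • v - T v
      map_add' := fun v w ↦ by rw [map_add, smul_add]; abel
      map_smul' := fun a v ↦ by
        rw [map_smul, RingHom.id_apply, smul_sub,
          smul_algebra_smul_comm] }
  refine ⟨k, fun v ↦ ?_⟩
  rcases D.bijective_or_eq_zero with hD | hD
  · refine absurd (ContinuousLinearMap.isUnit_iff_bijective.2 ?_) (spectrum.mem_iff.1 hk)
    rwa [show ⇑(algebraMap ℂ ((A ⧸ M) →L[ℂ] (A ⧸ M)) k - S) = D from funext hker]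
  · exact (sub_eq_zero.1 congr($hD v)).symm

/-- An eigenvalue of the action of `a` on a module is bounded by the norm of `a`. -/
lemma norm_le_of_smul_eq_smul {V : Type*} [AddCommGroup V] [Module ℂ V] [Module A V]
    [IsScalarTower ℂ A V] {a : A} {v : V} {k : ℂ} (hv : v ≠ 0) (h : a • v = k • v) :
    ‖k‖ ≤ ‖a‖ * ‖(1 : A)‖ := by
  apply spectrum.norm_le_norm_mul_of_mem
  rw [spectrum.mem_iff]
  intro hu
  apply hv
  rw [← hu.smul_eq_zero, sub_smul, h, algebraMap_smul, sub_self]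

omit [CompleteSpace A] in
lemma norm_iterate_le (δ : A →L[ℂ] A) (n : ℕ) (x : A) : ‖δ^[n] x‖ ≤ ‖δ‖ ^ n * ‖x‖ := by
  induction n with
  | zero => simp
  | succ n ih =>
    rw [Function.iterate_succ_apply', pow_succ', mul_assoc]
    exact (δ.le_opNorm _).trans (by gcongr)

lemma eq_zero_of_factorial_mul_pow_le {k : ℂ} {C D : ℝ}
    (h : ∀ n : ℕ, 0 < n → ‖(n.factorial : ℂ) * k ^ n‖ ≤ C ^ n * D) : k = 0 := by
  by_contra hk
  have hk' : 0 < ‖k‖ := norm_pos_iff.2 hk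
  have hlim := (FloorSemiring.tendsto_pow_div_factorial_atTop (C / ‖k‖)).mul_const D
  rw [zero_mul] at hlim
  have h1 : ∀ᶠ n : ℕ in atTop, (1 : ℝ) ≤ (C / ‖k‖) ^ n / n.factorial * D := by
    filter_upwards [eventually_gt_atTop 0] with n hn
    have h2 := h n hn
    rw [norm_mul, norm_pow, Complex.norm_natCast] at h2
    have hf : (0 : ℝ) < n.factorial := by positivity
    rw [div_pow, div_div, div_mul_eq_mul_div, le_div_iff₀ (by positivity)]
    linarith
  exact absurd (ge_of_tendsto hlim h1) (by norm_num)

theorem IsJordanLeftDerivation.eq_zero (hss : Ideal.jacobson (⊥ : Ideal A) = ⊥) {δ : A →L[ℂ] A}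
    (hδ : IsJordanLeftDerivation (δ : A →ₗ[ℂ] A)) : δ = 0 := by
  have hmem (a : A) (h : ∀ M : Ideal A, M.IsMaximal → a ∈ M) : a = 0 := by
    rw [← Ideal.mem_bot, ← hss, Ideal.jacobson, Ideal.mem_sInf]
    exact fun _ hJ ↦ h _ hJ.2
  have hmk (M : Ideal A) (a : A) : a • M.mkQ 1 = 0 ↔ a ∈ M := by
    rw [← map_smul, smul_eq_mul, mul_one, Submodule.mkQ_apply, Submodule.Quotient.mk_eq_zero]
  have hone (M : Ideal A) (hM : M.IsMaximal) : M.mkQ 1 ≠ 0 := by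
    intro h
    exact hM.ne_top ((Ideal.eq_top_iff_one M).2 ((hmk M 1).1 (by rw [one_smul, h])))
  have hcen (a b : A) : Commute ((δ : A →ₗ[ℂ] A) a) b := by
    refine sub_eq_zero.1 (hmem _ fun M hM ↦ (hmk M _).1 ?_)
    have : IsSimpleModule A (A ⧸ M) := isSimpleModule_iff_isCoatom.2 hM.out
    exact hδ.commutator_smul (exists_endomorphism_eq_smul M) a b (hone M hM)
  ext x
  refine hmem _ fun M hM ↦ ?_
  by_contra hx
  have : IsSimpleModule A (A ⧸ M) := isSimpleModule_iff_isCoatom.2 hM.out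
  have hv : (δ : A →ₗ[ℂ] A) x • M.mkQ 1 ≠ 0 := fun h ↦ hx ((hmk M _).1 h)
  have hS := exists_endomorphism_eq_smul M
  obtain ⟨m, hm⟩ := hδ.exists_smul_eq_of_map_smul_ne_zero hS hv x (hone M hM)
  obtain ⟨k, hk⟩ := hδ.exists_smul_eq_of_map_smul_ne_zero hS hv ((δ : A →ₗ[ℂ] A) x) (hone M hM)
  set z := x - algebraMap ℂ A m
  have hz : (δ : A →ₗ[ℂ] A) z = (δ : A →ₗ[ℂ] A) x := by
    rw [map_sub, Algebra.algebraMap_eq_smul_one, map_smul, hδ.map_one, smul_zero, sub_zero]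
  have hzv : z • M.mkQ 1 = 0 := by rw [sub_smul, hm, algebraMap_smul, sub_self]
  have hk0 : k = 0 := by
    refine eq_zero_of_factorial_mul_pow_le (C := ‖δ‖ * ‖z‖) (D := ‖(1 : A)‖) fun n hn ↦ ?_
    have h := hδ.iterate_pow_mul_smul hcen hzv (hz ▸ hk) n (Commute.one_right z)
    rw [mul_one, one_smul] at h
    refine (norm_le_of_smul_eq_smul (hone M hM) h).trans ?_
    gcongr
    rw [mul_pow]
    refine (norm_iterate_le δ n _).trans ?_
    gcongr
    exact norm_pow_le' z hn
  exact hv (by rw [hk, hk0, zero_smul])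

/-- An identity between first-order expansions of `δ (u (1 - t x)⁻¹)` for small `t ≠ 0` persists
at `t = 0`. -/
lemma map_eq_add_mul_of_inverse_one_sub_smul (δ : A →L[ℂ] A) (x u p v q : A)
    (h : ∀ (t : ℂ) (b : A), t ≠ 0 → (1 - t • x) * b = 1 → b * (1 - t • x) = 1 →
      δ (u * b) - p - t • (x * δ (u * b)) - v * b * q = 0) :
    δ u = p + v * q := by
  have ht : Tendsto (fun t : ℂ ↦ t) (𝓝[≠] 0) (𝓝 0) := tendsto_id.mono_left nhdsWithin_le_nhds
  have hc : Tendsto (fun t : ℂ ↦ 1 - t • x) (𝓝[≠] 0) (𝓝 ((1 : Aˣ) : A)) := by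
    simpa using (ht.smul_const x).const_sub 1
  have hb : Tendsto (fun t : ℂ ↦ Ring.inverse (1 - t • x)) (𝓝[≠] 0) (𝓝 1) := by
    simpa [Function.comp_def] using (NormedRing.inverse_continuousAt (1 : Aˣ)).tendsto.comp hc
  have hzero : ∀ᶠ t in 𝓝[≠] (0 : ℂ), δ (u * Ring.inverse (1 - t • x)) - p -
      t • (x * δ (u * Ring.inverse (1 - t • x))) - v * Ring.inverse (1 - t • x) * q = 0 := by
    filter_upwards [self_mem_nhdsWithin, hc.eventually (Units.nhds 1)] with t ht hu
    exact h t _ ht (Ring.mul_inverse_cancel _ hu) (Ring.inverse_mul_cancel _ hu)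
  have hd := (δ.continuous.tendsto _).comp (hb.const_mul u)
  have hlim := ((hd.sub (tendsto_const_nhds (x := p))).sub (ht.smul (hd.const_mul x))).sub
    ((hb.const_mul v).mul_const q)
  have heq := tendsto_nhds_unique hlim ((tendsto_congr' hzero).2 tendsto_const_nhds)
  rwa [zero_smul, mul_one, mul_one, sub_zero, sub_sub, sub_eq_zero] at heq

/-- A continuous linear map which is Jordan left derivable at a central left separating point
is a Jordan left derivation. -/
lemma isJordanLeftDerivation_of_derivableAt (δ : A →L[ℂ] A) (W : A) (hWc : ∀ b : A, W * b = b * W)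
    (hsep : ∀ a : A, W * a = 0 → a = 0)
    (h : ∀ a b : A, a * b + b * a = W →
      δ (a * b + b * a) = 2 * (a * δ b) + 2 * (b * δ a)) :
    IsJordanLeftDerivation (δ : A →ₗ[ℂ] A) := by
  have hinv (a b : A) (hab : a * b = 1) (hba : b * a = 1) :
      δ W = a * δ (W * b) + W * b * δ a := by
    have h1 : a * (W * ((2⁻¹ : ℂ) • b)) + W * ((2⁻¹ : ℂ) • b) * a = W := by
      rw [← mul_assoc, ← hWc a, mul_assoc, mul_assoc, mul_smul_comm, smul_mul_assoc, hab, hba,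
        ← mul_add, ← add_smul]
      norm_num
    have h2 := h _ _ h1
    rw [h1] at h2
    rw [h2, mul_smul_comm, map_smul, mul_smul_comm, smul_mul_assoc]
    have h3 (c : A) : 2 * (2⁻¹ : ℂ) • c = c := by
      rw [two_mul, ← add_smul]; norm_num
    rw [h3, h3]
  have hone : δ 1 = 0 := by
    have := hinv 1 1 (one_mul 1) (one_mul 1)
    rw [mul_one, one_mul] at this
    exact hsep _ (by simpa using this)
  have hW (x : A) : δ (W * x) = x * δ W + W * δ x := by
    refine map_eq_add_mul_of_inverse_one_sub_smul δ x _ _ _ _ fun t b ht hab hba ↦ ?_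
    have hbt : b = 1 + t • (x * b) := by
      rw [sub_mul, one_mul, smul_mul_assoc, sub_eq_iff_eq_add] at hab
      exact hab
    have hWb : δ (W * b) = δ W + t • δ (W * x * b) := by
      conv_lhs => rw [hbt]
      rw [mul_add, mul_one, mul_smul_comm, map_add, map_smul, mul_assoc]
    have h1 := hinv _ _ hab hba
    rw [hWb, map_sub, hone, map_smul] at h1
    rw [← smul_eq_zero_iff_right ht]
    rw [← sub_eq_zero, ← neg_eq_zero] at h1
    rw [← h1]
    simp only [sub_mul, mul_add, smul_sub, one_mul, mul_smul_comm, smul_mul_assoc, zero_sub,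
      mul_neg]
    abel
  intro x
  change δ (x * x) = 2 * (x * δ x)
  rw [two_mul]
  refine map_eq_add_mul_of_inverse_one_sub_smul δ x _ _ _ _ fun t b ht hab hba ↦ ?_
  have hbt : b = 1 + t • (x * b) := by
    rw [sub_mul, one_mul, smul_mul_assoc, sub_eq_iff_eq_add] at hab
    exact hab
  have hδb : δ b = t • δ x + (t * t) • δ (x * x * b) := by
    conv_lhs => rw [hbt, hbt]
    rw [map_add, hone, zero_add, mul_add, mul_one, smul_add, map_add, map_smul, mul_smul_comm,
      smul_smul, map_smul, mul_assoc]
  have h1 : (1 - t • x) * δ b + b * δ (1 - t • x) = 0 := by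
    apply hsep
    have h2 := hinv _ _ hab hba
    rw [hW, mul_add, ← mul_assoc, hab, one_mul, add_assoc, left_eq_add, ← mul_assoc,
      ← hWc] at h2
    rw [mul_add, ← mul_assoc, ← mul_assoc]
    exact h2
  rw [hδb, map_sub, hone, map_smul] at h1
  rw [← smul_eq_zero_iff_right (mul_ne_zero ht ht), ← h1]
  nth_rw 5 [hbt]
  simp only [sub_mul, mul_add, add_mul, smul_sub, smul_add, one_mul, mul_smul_comm,
    smul_mul_assoc, zero_sub, mul_neg, smul_smul, mul_assoc]
  abel

end Banach

/-- On a unital semisimple Banach algebra, a continuous linear map which is Jordan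
left derivable at a central left separating point `W` is zero. -/
theorem stmt_9
    {A : Type*} [NormedRing A] [NormedAlgebra ℂ A] [CompleteSpace A]
    (hss : Ideal.jacobson (⊥ : Ideal A) = ⊥)
    (δ : A →L[ℂ] A) (W : A) (hWc : ∀ b : A, W * b = b * W)
    (hsep : ∀ a : A, W * a = 0 → a = 0)
    (h : ∀ a b : A, a * b + b * a = W →
      δ (a * b + b * a) = 2 * (a * δ b) + 2 * (b * δ a)) :
    δ = 0 := by
  exact (isJordanLeftDerivation_of_derivableAt δ W hWc hsep h).eq_zero hss
end

section
/- Let 𝒜 be a complex Banach algebra with identity I, let ℳ be a Banach left 𝒜-module, and let δ : 𝒜 → ℳ be a linear map for which there exists ξ ∈ ℳ such that δ(AB + BA) = 2Aδ(B) + 2Bδ(A) − (AB + BA)ξ for all A, B ∈ 𝒜. Then δ is a Jordan left derivation if and only if I·δ(I) = 0. -/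
/-- For a generalized Jordan left derivation `δ` (with `ξ ∈ ℳ`) on a unital Banach
algebra, `δ` is a Jordan left derivation iff `1 • δ(1) = 0`. -/
theorem stmt_12
    {A : Type*} [NormedRing A] [NormedAlgebra ℂ A] [CompleteSpace A]
    {M : Type*} [NormedAddCommGroup M] [NormedSpace ℂ M] [CompleteSpace M]
    [Module A M] [IsScalarTower ℂ A M]
    (hact : Continuous fun p : A × M => p.1 • p.2)
    (δ : A →ₗ[ℂ] M) (ξ : M)
    (hξ : ∀ a b : A, δ (a * b + b * a) =
      (2 : ℂ) • (a • δ b) + (2 : ℂ) • (b • δ a) - (a * b + b * a) • ξ) :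
    (∀ a b : A, δ (a * b + b * a) = (2 : ℂ) • (a • δ b) + (2 : ℂ) • (b • δ a)) ↔
      (1 : A) • δ 1 = 0 := by
  have h1 := hξ 1 1
  have two_add (x : M) : (2 : ℂ) • x = x + x := two_smul ℂ x
  have hδ : δ 1 = ξ := by
    simp only [mul_one, one_smul, map_add, add_smul, two_add] at h1
    have h : (2 : ℂ) • (δ 1 - ξ) = 0 := by
      rw [two_add, ← sub_eq_zero.mpr h1.symm]
      abel
    exact sub_eq_zero.mp ((smul_eq_zero.mp h).resolve_left two_ne_zero)
  rw [one_smul, hδ]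
  constructor
  · intro h
    have h2 := (h 1 1).symm.trans (hξ 1 1)
    rw [eq_comm, sub_eq_self, mul_one, add_smul, one_smul, ← two_add] at h2
    exact (smul_eq_zero.mp h2).resolve_left two_ne_zero
  · intro h a b
    rw [hξ, h, smul_zero, sub_zero]
end

section
/- Let 𝒜 be a complex Banach algebra with identity which has property (𝔹), let ℳ be a Banach left 𝒜-module with Rann_ℳ(𝒜) = {0}, and let δ : 𝒜 → ℳ be a continuous linear map. Then δ satisfies condition (D1) if and only if for every C ∈ 𝒜 there exists ξ ∈ ℳ such that C·δ(AB) = A(C·δ(B)) + B(C·δ(A)) − (AB)ξ for all A, B ∈ 𝒜. -/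
/-- A property (𝔹) that is only assumed for bilinear maps into spaces in `Type` passes to jointly
continuous bilinear maps into normed spaces in any universe, by testing against functionals. -/
theorem bilin_mul_eq_of_zero_product
    {A : Type*} [NormedRing A] [NormedAlgebra ℂ A]
    {M : Type*} [NormedAddCommGroup M] [NormedSpace ℂ M]
    (hB : ∀ (X : Type) [NormedAddCommGroup X] [NormedSpace ℂ X] [CompleteSpace X]
      (φ : A →L[ℂ] A →L[ℂ] X), (∀ a b : A, a * b = 0 → φ a b = 0) →
      ∀ a b c : A, φ (a * b) c = φ a (b * c))
    (T : A →ₗ[ℂ] A →ₗ[ℂ] M) (hT : Continuous fun p : A × A => T p.1 p.2)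
    (hzero : ∀ a b : A, a * b = 0 → T a b = 0) (a b c : A) :
    T (a * b) c = T a (b * c) := by
  rw [SeparatingDual.eq_iff_forall_dual_eq (R := ℂ)]
  intro f
  have hsep : ∀ x : A, Continuous (T x) := fun x => hT.comp (Continuous.prodMk_right x)
  let S : A →ₗ[ℂ] A →L[ℂ] ℂ :=
    { toFun := fun x => f.comp ⟨T x, hsep x⟩
      map_add' := fun x y => by ext z; simp
      map_smul' := fun r x => by ext z; simp }
  have hS : Continuous S :=
    ContinuousLinearMap.continuous_of_continuous_uncurry S (f.continuous.comp hT)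
  refine hB ℂ ⟨S, hS⟩ (fun x y hxy => ?_) a b c
  change f (T x y) = 0
  rw [hzero x y hxy, map_zero]

/-- If `(a * c) • δ b` vanishes whenever `a * b = b * c = 0`, then over an algebra with
property (𝔹) each map `c • δ` is a generalized left derivation. -/
theorem smul_map_mul_of_zero_product
    {A : Type*} [NormedRing A] [NormedAlgebra ℂ A]
    {M : Type*} [NormedAddCommGroup M] [NormedSpace ℂ M]
    [Module A M] [IsScalarTower ℂ A M] [ContinuousSMul A M]
    (hB : ∀ (X : Type) [NormedAddCommGroup X] [NormedSpace ℂ X] [CompleteSpace X]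
      (φ : A →L[ℂ] A →L[ℂ] X), (∀ a b : A, a * b = 0 → φ a b = 0) →
      ∀ a b c : A, φ (a * b) c = φ a (b * c))
    (δ : A →L[ℂ] M)
    (hδ : ∀ a b c : A, a * b = 0 → b * c = 0 → (a * c) • δ b = 0) (a b c : A) :
    c • δ (a * b) = a • (c • δ b) + b • (c • δ a) - (a * b) • (c • δ 1) := by
  have : SMulCommClass ℂ A M := IsScalarTower.to_smulCommClass
  have hright : ∀ x y z w : A, x * y = 0 → (x * w) • δ (y * z) = (x * (z * w)) • δ y := by
    intro x y z w hxy
    let T : A →ₗ[ℂ] A →ₗ[ℂ] M := LinearMap.mk₂ ℂ (fun u v => (x * v) • δ (y * u))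
      (by intros; simp [mul_add])
      (fun r u v => by rw [mul_smul_comm, map_smul, smul_comm])
      (by intros; simp [mul_add, add_smul])
      (by intros; simp)
    have h := bilin_mul_eq_of_zero_product hB T
      (by simp only [T, LinearMap.mk₂_apply]; fun_prop)
      (fun u v huv => hδ x (y * u) v (by rw [← mul_assoc, hxy, zero_mul])
        (by rw [mul_assoc, huv, mul_zero])) 1 z w
    simpa [T] using h
  let T : A →ₗ[ℂ] A →ₗ[ℂ] M :=
    LinearMap.mk₂ ℂ (fun u v => (u * c) • δ (v * b) - (u * (b * c)) • δ v)
      (by intros; simp only [add_mul, add_smul]; abel)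
      (by intros; simp [smul_sub])
      (by intros; simp only [add_mul, map_add, smul_add]; abel)
      (fun r u v => by
        rw [smul_mul_assoc, map_smul, map_smul, smul_comm _ r, smul_comm _ r, smul_sub])
  have h := bilin_mul_eq_of_zero_product hB T
    (by simp only [T, LinearMap.mk₂_apply]; fun_prop)
    (fun u v huv => sub_eq_zero.2 (hright u v b c huv)) 1 a 1
  simp only [T, LinearMap.mk₂_apply, one_mul, mul_one, mul_smul, one_smul] at h
  rw [sub_eq_sub_iff_add_eq_add] at h
  rw [mul_smul, eq_sub_iff_add_eq]
  exact h.symm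


/-- Over a unital Banach algebra with property (𝔹) and a Banach left module with
trivial right annihilator, a continuous linear map `δ` satisfies (D1) iff for every
`C`, `C·δ` is a generalized left derivation (with some `ξ ∈ ℳ`). -/
theorem stmt_15
    {A : Type*} [NormedRing A] [NormedAlgebra ℂ A] [CompleteSpace A]
    {M : Type*} [NormedAddCommGroup M] [NormedSpace ℂ M] [CompleteSpace M]
    [Module A M] [IsScalarTower ℂ A M]
    (hact : Continuous fun p : A × M => p.1 • p.2)
    (hB : ∀ (X : Type) [NormedAddCommGroup X] [NormedSpace ℂ X] [CompleteSpace X]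
      (φ : A →L[ℂ] A →L[ℂ] X), (∀ a b : A, a * b = 0 → φ a b = 0) →
      ∀ a b c : A, φ (a * b) c = φ a (b * c))
    (hrann : ∀ m : M, (∀ a : A, a • m = 0) → m = 0)
    (δ : A →L[ℂ] M) :
    (∀ a b c : A, a * b = 0 → b * c = 0 → (a * c) • δ b = 0) ↔
      ∀ C : A, ∃ ξ : M, ∀ a b : A,
        C • δ (a * b) = a • (C • δ b) + b • (C • δ a) - (a * b) • ξ := by
  have : ContinuousSMul A M := ⟨hact⟩
  constructor
  · exact fun hδ C => ⟨C • δ 1, fun a b => smul_map_mul_of_zero_product hB δ hδ a b C⟩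
  · intro h a b c hab hbc
    obtain ⟨ξ, hξ⟩ := h c
    have key := hξ a b
    rw [hab, map_zero, smul_zero, zero_smul, sub_zero, ← mul_smul b, hbc, zero_smul, add_zero,
      ← mul_smul] at key
    exact key.symm
end

section
/- Let 𝒜 be a complex Banach algebra with identity which has property (𝔹), let ℳ be a Banach left 𝒜-module with Rann_ℳ(𝒜) = {0}, and let δ : 𝒜 → ℳ be a continuous linear map. If δ satisfies condition (D2), then for every C ∈ 𝒜 there exists ξ ∈ ℳ such that C·δ(AB) = A(C·δ(B)) + B(C·δ(A)) − (AB)ξ for all A, B ∈ 𝒜. -/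
open Filter Topology in
/-- A separately continuous bilinear map is jointly continuous if its first factor and its codomain
are Banach spaces. -/
theorem LinearMap.exists_continuousBilinear_of_separately_continuous
    {𝕜 E F G : Type*} [NontriviallyNormedField 𝕜]
    [NormedAddCommGroup E] [NormedSpace 𝕜 E] [CompleteSpace E]
    [NormedAddCommGroup F] [NormedSpace 𝕜 F]
    [NormedAddCommGroup G] [NormedSpace 𝕜 G] [CompleteSpace G]
    (p : E →ₗ[𝕜] F →ₗ[𝕜] G) (hl : ∀ y, Continuous fun x => p x y) (hr : ∀ x, Continuous (p x)) :
    ∃ φ : E →L[𝕜] F →L[𝕜] G, ∀ x y, φ x y = p x y := by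
  let L : E →ₗ[𝕜] F →L[𝕜] G :=
    { toFun := fun x => ⟨p x, hr x⟩
      map_add' := fun x x' => by ext y; simp
      map_smul' := fun c x => by ext y; simp }
  have hL : Continuous L := L.continuous_of_seq_closed_graph fun u x T hu hT => by
    ext y
    have h₁ : Tendsto (fun n => L (u n) y) atTop (𝓝 (T y)) :=
      ((ContinuousLinearMap.apply 𝕜 G y).continuous.tendsto T).comp hT
    exact tendsto_nhds_unique h₁ (((hl y).tendsto x).comp hu)
  exact ⟨⟨L, hL⟩, fun x y => rfl⟩

/-- Over a unital Banach algebra with property (𝔹) and a Banach left module with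
trivial right annihilator, if a continuous linear map `δ` satisfies (D2), then for
every `C`, `C·δ` is a generalized left derivation (with some `ξ ∈ ℳ`). -/
theorem stmt_16
    {A : Type*} [NormedRing A] [NormedAlgebra ℂ A] [CompleteSpace A]
    {M : Type*} [NormedAddCommGroup M] [NormedSpace ℂ M] [CompleteSpace M]
    [Module A M] [IsScalarTower ℂ A M]
    (hact : Continuous fun p : A × M => p.1 • p.2)
    (hB : ∀ (X : Type) [NormedAddCommGroup X] [NormedSpace ℂ X] [CompleteSpace X]
      (φ : A →L[ℂ] A →L[ℂ] X), (∀ a b : A, a * b = 0 → φ a b = 0) →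
      ∀ a b c : A, φ (a * b) c = φ a (b * c))
    (hrann : ∀ m : M, (∀ a : A, a • m = 0) → m = 0)
    (δ : A →L[ℂ] M)
    (hD2 : ∀ a b : A, a * b = 0 → a • δ b + b • δ a = 0) :
    ∀ C : A, ∃ ξ : M, ∀ a b : A,
      C • δ (a * b) = a • (C • δ b) + b • (C • δ a) - (a * b) • ξ := by
  have hcomm : ∀ (c : ℂ) (a : A) (m : M), a • c • m = c • a • m := fun c a m => by
    rw [← one_smul A m, ← smul_assoc c (1 : A) m, ← mul_smul, mul_smul_comm, smul_assoc, mul_smul]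
  have key : ∀ a b c : A,
      (a * b) • δ c + c • δ (a * b) = a • δ (b * c) + (b * c) • δ a := by
    intro a b c
    rw [SeparatingDual.eq_iff_forall_dual_eq (R := ℂ)]
    intro f
    obtain ⟨φ, hφ⟩ := LinearMap.exists_continuousBilinear_of_separately_continuous
      (LinearMap.mk₂ ℂ (fun x y : A => f (x • δ y + y • δ x))
        (fun x x' y => by simp only [map_add, add_smul, smul_add]; ring)
        (fun r x y => by simp only [map_smul, smul_assoc, hcomm, ← smul_add])
        (fun x y y' => by simp only [map_add, add_smul, smul_add]; ring)
        (fun r x y => by simp only [map_smul, smul_assoc, hcomm, ← smul_add]))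
      (fun y => f.continuous.comp ((hact.comp (continuous_id.prodMk continuous_const)).add
        (hact.comp (continuous_const.prodMk δ.continuous))))
      (fun x => f.continuous.comp ((hact.comp (continuous_const.prodMk δ.continuous)).add
        (hact.comp (continuous_id.prodMk continuous_const))))
    have h := hB ℂ φ (fun x y hxy => by rw [hφ, LinearMap.mk₂_apply, hD2 x y hxy, map_zero]) a b c
    simpa only [hφ, LinearMap.mk₂_apply] using h
  intro c
  refine ⟨c • δ 1, fun a b => ?_⟩
  have h₁ := key a b c
  have h₂ := congrArg (a • ·) (key 1 b c)
  simp only [one_mul, one_smul, smul_add, ← mul_smul, mul_assoc] at h₁ h₂ ⊢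
  rw [← sub_eq_zero] at h₁ h₂ ⊢
  rw [← sub_zero (0 : M)]
  nth_rewrite 1 [← h₁]
  rw [← h₂]
  abel
end

section
/- Let 𝒜 be a complex Banach algebra with identity which has property (𝔹), let ℳ be a Banach left 𝒜-module, and let δ : 𝒜 → ℳ be a continuous linear map. Then δ satisfies condition (D3) if and only if there exists ξ ∈ ℳ such that δ(AB + BA) = 2Aδ(B) + 2Bδ(A) − (AB + BA)ξ for all A, B ∈ 𝒜. -/
/-- A jointly continuous bilinear map of normed spaces is a continuous linear map into the space of
continuous linear maps. -/
theorem LinearMap.exists_continuousLinearMap_of_continuous₂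
    {E F G : Type*} [NormedAddCommGroup E] [NormedSpace ℂ E] [NormedAddCommGroup F]
    [NormedSpace ℂ F] [NormedAddCommGroup G] [NormedSpace ℂ G] (f : E →ₗ[ℂ] F →ₗ[ℂ] G)
    (hf : Continuous fun p : E × F => f p.1 p.2) :
    ∃ g : E →L[ℂ] F →L[ℂ] G, ∀ x y, g x y = f x y := by
  obtain ⟨ε, hε, h⟩ := Metric.continuousAt_iff.1 (hf.continuousAt (x := (0, 0))) 1 one_pos
  refine ⟨f.mkContinuous₂ ((2 / ε) * (2 / ε)) fun x y => ?_, fun x y => rfl⟩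
  rcases eq_or_ne x 0 with rfl | hx
  · simp
  rcases eq_or_ne y 0 with rfl | hy
  · simp
  have hx' : 0 < ‖x‖ := norm_pos_iff.2 hx
  have hy' : 0 < ‖y‖ := norm_pos_iff.2 hy
  set s : ℝ := ε / 2 / ‖x‖ with hs
  set t : ℝ := ε / 2 / ‖y‖ with ht
  have hs0 : 0 < s := by positivity
  have ht0 : 0 < t := by positivity
  have hsx : ‖(s : ℂ) • x‖ < ε := by
    rw [norm_smul, Complex.norm_real, Real.norm_of_nonneg hs0.le, hs, div_mul_cancel₀ _ hx'.ne']
    linarith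
  have hty : ‖(t : ℂ) • y‖ < ε := by
    rw [norm_smul, Complex.norm_real, Real.norm_of_nonneg ht0.le, ht, div_mul_cancel₀ _ hy'.ne']
    linarith
  have key := @h ((s : ℂ) • x, (t : ℂ) • y) (by
    rw [dist_eq_norm, Prod.mk_sub_mk, sub_zero, sub_zero, Prod.norm_mk]
    exact max_lt hsx hty)
  simp only [map_zero, dist_zero_right, map_smul, LinearMap.smul_apply, norm_smul,
    Complex.norm_real, Real.norm_of_nonneg hs0.le, Real.norm_of_nonneg ht0.le] at key
  have hst : (2 / ε) * (2 / ε) * ‖x‖ * ‖y‖ = 1 / (t * s) := by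
    rw [hs, ht]; field_simp
  rw [hst, le_div_iff₀ (by positivity)]
  linarith

/-- Property (𝔹) for scalar-valued bilinear maps implies property (𝔹) for bilinear maps with values
in an arbitrary normed space. -/
theorem map_mul_eq_map_mul_of_forall_scalar
    {A : Type*} [NormedRing A] [NormedAlgebra ℂ A]
    (hB : ∀ φ : A →L[ℂ] A →L[ℂ] ℂ, (∀ a b : A, a * b = 0 → φ a b = 0) →
      ∀ a b c : A, φ (a * b) c = φ a (b * c))
    {X : Type*} [NormedAddCommGroup X] [NormedSpace ℂ X]
    (φ : A →L[ℂ] A →L[ℂ] X) (hφ : ∀ a b : A, a * b = 0 → φ a b = 0) (a b c : A) :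
    φ (a * b) c = φ a (b * c) := by
  refine (SeparatingDual.eq_iff_forall_dual_eq (R := ℂ)).2 fun g => ?_
  exact hB ((ContinuousLinearMap.compL ℂ A X ℂ g).comp φ)
    (fun a b hab => by simp [hφ a b hab]) a b c

/-- On a unital algebra with property (𝔹), a continuous bilinear map that vanishes on pairs with
`a * b = b * a = 0` is determined, up to symmetrization, by its values on pairs containing `1`. -/
theorem map_add_map_swap_of_map_eq_zero
    {A : Type*} [NormedRing A] [NormedAlgebra ℂ A]
    (hB : ∀ φ : A →L[ℂ] A →L[ℂ] ℂ, (∀ a b : A, a * b = 0 → φ a b = 0) →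
      ∀ a b c : A, φ (a * b) c = φ a (b * c))
    {X : Type*} [NormedAddCommGroup X] [NormedSpace ℂ X]
    (φ : A →L[ℂ] A →L[ℂ] X) (hφ : ∀ a b : A, a * b = 0 → b * a = 0 → φ a b = 0) (x y : A) :
    φ x y + φ y x = φ 1 (x * y) + φ (y * x) 1 := by
  have inner : ∀ a b : A, a * b = 0 → φ (b * x) a = φ b (x * a) := by
    intro a b hab
    have := map_mul_eq_map_mul_of_forall_scalar hB
      (φ.bilinearComp (ContinuousLinearMap.mul ℂ A b) ((ContinuousLinearMap.mul ℂ A).flip a))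
      (fun c d hcd => by
        simp only [ContinuousLinearMap.bilinearComp_apply, ContinuousLinearMap.mul_apply',
          ContinuousLinearMap.flip_apply]
        refine hφ _ _ ?_ ?_
        · rw [mul_assoc, ← mul_assoc c, hcd, zero_mul, mul_zero]
        · rw [mul_assoc, ← mul_assoc a, hab, zero_mul, mul_zero]) 1 x 1
    simpa using this
  have outer := map_mul_eq_map_mul_of_forall_scalar hB
    (φ.bilinearComp ((ContinuousLinearMap.mul ℂ A).flip x) (ContinuousLinearMap.id ℂ A) -
      φ.bilinearComp (ContinuousLinearMap.id ℂ A) (ContinuousLinearMap.mul ℂ A x)).flip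
    (fun a b hab => by simp [inner a b hab]) 1 y 1
  simp only [ContinuousLinearMap.flip_apply, sub_apply,
    ContinuousLinearMap.bilinearComp_apply, ContinuousLinearMap.mul_apply',
    ContinuousLinearMap.id_apply, one_mul, mul_one] at outer
  rw [sub_eq_sub_iff_add_eq_add] at outer
  rw [outer, add_comm]


/-- Over a unital Banach algebra with property (𝔹), a continuous linear map `δ`
into a Banach left module satisfies (D3) iff `δ` is a generalized Jordan left
derivation with some `ξ ∈ ℳ`. -/
theorem stmt_17
    {A : Type*} [NormedRing A] [NormedAlgebra ℂ A] [CompleteSpace A]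
    {M : Type*} [NormedAddCommGroup M] [NormedSpace ℂ M] [CompleteSpace M]
    [Module A M] [IsScalarTower ℂ A M]
    (hact : Continuous fun p : A × M => p.1 • p.2)
    (hB : ∀ (X : Type) [NormedAddCommGroup X] [NormedSpace ℂ X] [CompleteSpace X]
      (φ : A →L[ℂ] A →L[ℂ] X), (∀ a b : A, a * b = 0 → φ a b = 0) →
      ∀ a b c : A, φ (a * b) c = φ a (b * c))
    (δ : A →L[ℂ] M) :
    (∀ a b : A, a * b = 0 → b * a = 0 → a • δ b + b • δ a = 0) ↔
      ∃ ξ : M, ∀ a b : A, δ (a * b + b * a) =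
        (2 : ℂ) • (a • δ b) + (2 : ℂ) • (b • δ a) - (a * b + b * a) • ξ := by
  constructor
  · intro hδ
    have : SMulCommClass A ℂ M := by
      refine ⟨fun a c m => ?_⟩
      rw [← one_smul A m, ← smul_assoc c (1 : A) m, ← mul_smul, mul_smul_comm, smul_assoc, mul_smul]
    obtain ⟨g, hg⟩ := (LinearMap.mk₂ ℂ (fun (a : A) (m : M) => a • m) add_smul
      (fun c a m => smul_assoc c a m) smul_add
      (fun c a m => smul_comm a c m)).exists_continuousLinearMap_of_continuous₂ hact
    simp only [LinearMap.mk₂_apply] at hg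
    let ψ : A →L[ℂ] A →L[ℂ] M := g.bilinearComp (ContinuousLinearMap.id ℂ A) δ
    have hψ : ∀ a b, (ψ + ψ.flip) a b = a • δ b + b • δ a := fun a b => by simp [ψ, hg]
    refine ⟨δ 1, fun a b => ?_⟩
    have key := map_add_map_swap_of_map_eq_zero (fun φ => hB ℂ φ) (ψ + ψ.flip)
      (fun a b hab hba => by rw [hψ]; exact hδ a b hab hba) a b
    simp only [hψ, one_smul] at key
    rw [map_add, add_smul, two_smul, two_smul, eq_sub_iff_add_eq]
    calc _ = δ (a * b) + (a * b) • δ 1 + ((b * a) • δ 1 + δ (b * a)) := by abel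
      _ = a • δ b + b • δ a + (b • δ a + a • δ b) := key.symm
      _ = _ := by abel
  · rintro ⟨ξ, hξ⟩ a b hab hba
    have h := hξ a b
    rw [hab, hba, add_zero, map_zero, zero_smul, sub_zero, ← smul_add] at h
    exact (smul_eq_zero.1 h.symm).resolve_left two_ne_zero
end
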